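/- arXiv:2305.05530 — 9 statements merged into one kernel-verified Lean document; each statement's English description precedes it below -/
import Mathlib

section
/- Let A be a unital complex Banach algebra and let f : A → ℂ be a (not necessarily linear) functional satisfying f(x) ∈ σ(x) and f(xy) = f(x)·f(y) for all x, y ∈ A. Then there exists a unique ℂ-linear functional ψ : A → ℂ with ψ(xy) = ψ(x)·ψ(y) for all x, y ∈ A such that ψ(x) = f(x) for every x in the connected component of 1 in the set of invertible elements of A. -/
open Filter Topology

/-- A continuous multiplicative character of the additive group of the reals is an exponential. -/
theorem exists_eq_exp_of_continuous_of_map_add {F : ℝ → ℂ} (hF : Continuous F) (h0 : F 0 = 1)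
    (hadd : ∀ s t, F (s + t) = F s * F t) : ∃ c : ℂ, ∀ t : ℝ, F t = Complex.exp (t * c) := by
  set G : ℝ → ℂ := fun t => ∫ s in (0 : ℝ)..t, F s with hG
  have hGd : ∀ t, HasDerivAt G (F t) t := fun t => hF.integral_hasStrictDerivAt 0 t |>.hasDerivAt
  obtain ⟨a, ha⟩ : ∃ a, G a ≠ 0 := by
    by_contra! h
    have h1 := hGd 0
    rw [show G = fun _ => 0 from funext h, h0] at h1
    exact one_ne_zero (h1.unique (hasDerivAt_const 0 0))
  have hFG : ∀ t, F t = (G (t + a) - G t) / G a := by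
    intro t
    rw [eq_div_iff ha]
    have h1 : F t * G a = ∫ s in (0 : ℝ)..a, F (t + s) := by
      simp only [hadd, hG, intervalIntegral.integral_const_mul]
    rw [h1, intervalIntegral.integral_comp_add_left (fun s => F s) t, add_zero]
    exact (intervalIntegral.integral_interval_sub_left (hF.intervalIntegrable _ _)
      (hF.intervalIntegrable _ _)).symm
  set c := (F a - 1) / G a with hc
  have hFd : ∀ t, HasDerivAt F (c * F t) t := by
    intro t
    have h1 := (((hGd (t + a)).comp_add_const t a).sub (hGd t)).div_const (G a)
    refine (h1.congr_of_eventuallyEq (.of_forall hFG)).congr_deriv ?_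
    rw [hadd, hc]
    ring
  refine ⟨c, fun t => ?_⟩
  have hE : ∀ t : ℝ, HasDerivAt (fun t : ℝ => Complex.exp (-(t * c)))
      (Complex.exp (-(t * c)) * (-(1 * c))) t := fun t =>
    ((Complex.ofRealCLM.hasDerivAt (x := t)).mul_const c).neg.cexp
  have hP : ∀ t, HasDerivAt (fun t : ℝ => F t * Complex.exp (-(t * c))) 0 t := by
    intro t
    convert! (hFd t).mul (hE t) using 1
    ring
  have h1 := is_const_of_deriv_eq_zero (fun t => (hP t).differentiableAt)
    (fun t => (hP t).deriv) t 0
  simp only [h0, Complex.ofReal_zero, zero_mul, neg_zero, Complex.exp_zero, mul_one] at h1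
  rw [Complex.exp_neg] at h1
  field_simp at h1
  exact h1

/-- A zero-free entire function of exponential type satisfies `φ' = c φ` for a constant `c`. -/
theorem exists_hasDerivAt_const_mul_of_exponential_growth {φ : ℂ → ℂ} (hφ : Differentiable ℂ φ)
    (hne : ∀ z, φ z ≠ 0) (h0 : φ 0 = 1) {K : ℝ} (hK : 0 < K)
    (hbd : ∀ z, ‖φ z‖ ≤ Real.exp (K * (1 + ‖z‖))) : ∃ c, ∀ z, HasDerivAt φ (c * φ z) z := by
  have hd : Differentiable ℂ (fun z => deriv φ z / φ z) := fun z =>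
    (hφ.contDiff.differentiable_deriv_two z).div (hφ z) (hne z)
  obtain ⟨g, hg0, hg⟩ := hd.isExactOn_univ.with_val_at 0 0
  have hg' : ∀ z, HasDerivAt g (deriv φ z / φ z) z := fun z => hg z (Set.mem_univ z)
  have hgd : Differentiable ℂ g := fun z => (hg' z).differentiableAt
  have hexp : ∀ z, φ z = Complex.exp (g z) := by
    intro z
    have hP : ∀ z, HasDerivAt (fun z => φ z * Complex.exp (-g z)) 0 z := by
      intro z
      convert! (hφ z).hasDerivAt.mul (hg' z).neg.cexp using 1
      field_simp [hne z]
      ring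
    have h1 := is_const_of_deriv_eq_zero (fun t => (hP t).differentiableAt)
      (fun t => (hP t).deriv) z 0
    simp only [h0, hg0, neg_zero, Complex.exp_zero, mul_one] at h1
    rw [Complex.exp_neg] at h1
    field_simp at h1
    exact h1
  have hre : ∀ z, (g z).re ≤ K * (1 + ‖z‖) := by
    intro z
    have := hbd z
    rwa [hexp, Complex.norm_exp, Real.exp_le_exp] at this
  have hgb : ∀ z, ‖g z‖ ≤ 4 * K * ‖z‖ := by
    intro z
    have hz := norm_nonneg z
    have h1 := Complex.borelCaratheodory_zero (f := g) (z := z) (M := K * (2 * ‖z‖ + 2))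
      (R := 2 * ‖z‖ + 1) (by positivity) hgd.differentiableOn
      (fun w hw => (hre w).trans (by
        have : ‖w‖ < 2 * ‖z‖ + 1 := by simpa using hw
        change K * (1 + ‖w‖) ≤ K * (2 * ‖z‖ + 2)
        exact mul_le_mul_of_nonneg_left (by linarith) hK.le)) (by positivity) (by simp; linarith) hg0
    refine h1.trans (le_of_eq ?_)
    rw [div_eq_iff (by linarith)]
    ring
  have hdb : ∀ z, ‖deriv g z‖ ≤ 8 * K := by
    intro z
    have hz := norm_nonneg z
    have h1 := Complex.norm_deriv_le_of_forall_mem_sphere_norm_le (c := z) (R := ‖z‖ + 1)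
      (C := 8 * K * (‖z‖ + 1)) (f := g) (by positivity) hgd.diffContOnCl (fun w hw => by
        refine (hgb w).trans ?_
        have h2 : ‖w - z‖ = ‖z‖ + 1 := by simpa using hw
        have h3 := norm_le_norm_sub_add w z
        nlinarith)
    rwa [mul_div_assoc, div_self (by positivity), mul_one] at h1
  refine ⟨deriv g 0, fun z => ?_⟩
  have h1 : deriv g z = deriv g 0 :=
    (hgd.contDiff.differentiable_deriv_two).apply_eq_apply_of_bounded
      (isBounded_iff_forall_norm_le.2 ⟨8 * K, by rintro _ ⟨w, rfl⟩; exact hdb w⟩) z 0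
  rw [← h1, (hg' z).deriv, div_mul_cancel₀ _ (hne z)]
  exact (hφ z).hasDerivAt

theorem norm_exp_le_norm_one_mul {A : Type*} [NormedRing A] [NormedAlgebra ℂ A] [CompleteSpace A]
    (x : A) : ‖NormedSpace.exp x‖ ≤ ‖(1 : A)‖ * Real.exp ‖x‖ := by
  have hpow : ∀ n : ℕ, ‖x ^ n‖ ≤ ‖(1 : A)‖ * ‖x‖ ^ n := by
    intro n
    induction n with
    | zero => simp
    | succ n ih =>
      rw [pow_succ, pow_succ, ← mul_assoc]
      exact (norm_mul_le _ _).trans (by gcongr)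
  rw [NormedSpace.exp_eq_tsum ℂ]
  have hs : HasSum (fun n : ℕ => ‖(1 : A)‖ * (‖x‖ ^ n / (n.factorial : ℝ)))
      (‖(1 : A)‖ * Real.exp ‖x‖) := by
    rw [Real.exp_eq_exp_ℝ]
    exact (NormedSpace.expSeries_div_hasSum_exp ‖x‖).mul_left _
  refine tsum_of_norm_bounded hs fun n => ?_
  rw [norm_smul, norm_inv, Complex.norm_natCast, ← mul_div_assoc, inv_mul_eq_div]
  gcongr
  exact hpow n

/-- A complex-linear functional that is multiplicative on squares is multiplicative. -/
theorem map_mul_of_map_mul_self {A : Type*} [Ring A] [Algebra ℂ A] (ψ : A →ₗ[ℂ] ℂ)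
    (h1 : ψ 1 = 1) (hsq : ∀ x, ψ (x * x) = ψ x * ψ x) (x y : A) : ψ (x * y) = ψ x * ψ y := by
  have hj : ∀ x y, ψ (x * y) + ψ (y * x) = 2 * (ψ x * ψ y) := by
    intro x y
    have h := hsq (x + y)
    simp only [add_mul, mul_add, map_add, hsq x, hsq y] at h
    linear_combination h
  have hker : ∀ x y, ψ x = 0 → ψ (x * y) = 0 := by
    intro x y hx
    have e : (x * y - y * x) * (x * y - y * x) =
        2 • (x * (y * x * y) + (y * x * y) * x) - (x * y + y * x) * (x * y + y * x) := by
      noncomm_ring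
    have h2 := hj x (y * x * y)
    have h3 := hj x y
    have h4 : ψ (x * y - y * x) * ψ (x * y - y * x) = 0 := by
      rw [← hsq, e, map_sub, hsq, map_nsmul, map_add, map_add, h2, h3, hx]
      simp
    have h5 := mul_self_eq_zero.1 h4
    rw [map_sub] at h5
    rw [hx] at h3
    linear_combination (h5 + h3) / 2
  have h := hker (x - ψ x • 1) y (by simp [h1])
  rw [sub_mul, map_sub, smul_mul_assoc, one_mul, map_smul, smul_eq_mul] at h
  exact sub_eq_zero.1 h

section

variable {A : Type*} [NormedRing A] [NormedAlgebra ℂ A]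

theorem exists_complexLinear_of_map_I_smul (L : A →L[ℝ] ℂ)
    (hL : ∀ x, L (Complex.I • x) = Complex.I * L x) : ∃ M : A →L[ℂ] ℂ, ∀ x, M x = L x := by
  refine ⟨⟨⟨⟨L, L.map_add⟩, fun c x => ?_⟩, L.continuous⟩, fun x => rfl⟩
  have e : c • x = c.re • x + c.im • (Complex.I • x) := by
    rw [← Complex.coe_smul, ← Complex.coe_smul, smul_smul, ← add_smul, Complex.re_add_im]
  change L (c • x) = c * L x
  rw [e, map_add, map_smul, map_smul, hL, Complex.real_smul, Complex.real_smul]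
  conv_rhs => rw [← Complex.re_add_im c]
  ring

theorem apply_smul_one_of_mem_spectrum {f : A → ℂ} (hspec : ∀ x, f x ∈ spectrum ℂ x) (c : ℂ) :
    f (c • 1) = c := by
  cases subsingleton_or_nontrivial A
  · have h := hspec 0
    rw [spectrum.of_subsingleton] at h
    exact h.elim
  · have h := hspec (c • 1)
    rw [← Algebra.algebraMap_eq_smul_one, spectrum.scalar_eq] at h
    rwa [← Algebra.algebraMap_eq_smul_one]

theorem apply_ne_zero_of_mem_spectrum {f : A → ℂ} (hspec : ∀ x, f x ∈ spectrum ℂ x) {x : A}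
    (hx : IsUnit x) : f x ≠ 0 := fun h =>
  (spectrum.zero_mem_iff ℂ).1 (h ▸ hspec x) hx

theorem hasDerivAt_cexp_ofReal_mul_zero (c : ℂ) :
    HasDerivAt (fun t : ℝ => Complex.exp (t * c)) c 0 := by
  simpa using ((Complex.ofRealCLM.hasDerivAt (x := 0)).mul_const c).cexp

theorem eq_of_forall_cexp_ofReal_mul_eq {a b : ℂ}
    (h : ∀ t : ℝ, Complex.exp (t * a) = Complex.exp (t * b)) : a = b :=
  ((hasDerivAt_cexp_ofReal_mul_zero a).congr_of_eventuallyEq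
    (.of_forall fun t => (h t).symm)).unique (hasDerivAt_cexp_ofReal_mul_zero b)

theorem eq_zero_of_norm_cexp_sub_one_le {γ : ℂ → A} (hγ : HasDerivAt γ 0 0) (hγ0 : γ 0 = 1)
    {c : ℂ} {D : ℝ} (h : ∀ t : ℝ, ‖Complex.exp (t * c) - 1‖ ≤ ‖γ t - 1‖ * D) : c = 0 := by
  refine (hasDerivAt_cexp_ofReal_mul_zero c).unique ?_
  rw [hasDerivAt_iff_isLittleO_nhds_zero] at hγ ⊢
  simp only [zero_add, hγ0, smul_zero, sub_zero, Complex.ofReal_zero, zero_mul,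
    Complex.exp_zero] at hγ ⊢
  have h1 : (fun t : ℝ => γ t - 1) =o[𝓝 0] fun t : ℝ => (t : ℂ) :=
    hγ.comp_tendsto (by simpa using Complex.continuous_ofReal.tendsto 0)
  refine Asymptotics.IsLittleO.trans_isBigO (Asymptotics.IsBigO.trans_isLittleO ?_ h1) ?_
  · exact Asymptotics.IsBigO.of_bound D (.of_forall fun t => by rw [mul_comm D]; exact h t)
  · exact Asymptotics.IsBigO.of_bound 1 (.of_forall fun t => by simp)

variable [CompleteSpace A]

theorem isUnit_exp_of_complex (x : A) : IsUnit (NormedSpace.exp x) :=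
  let _ := NormedAlgebra.restrictScalars ℚ ℂ A
  NormedSpace.isUnit_exp x

/-- **Gleason–Kahane–Żelazko theorem**. -/
theorem map_mul_of_ne_zero_of_isUnit (ψ : A →L[ℂ] ℂ) (h1 : ψ 1 = 1)
    (hne : ∀ x, IsUnit x → ψ x ≠ 0) (x y : A) : ψ (x * y) = ψ x * ψ y := by
  refine map_mul_of_map_mul_self ψ.toLinearMap h1 (fun x => ?_) x y
  change ψ (x * x) = ψ x * ψ x
  have hφ : ∀ z : ℂ, HasDerivAt (fun z : ℂ => ψ (NormedSpace.exp (z • x)))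
      (ψ (x * NormedSpace.exp (z • x))) z := fun z =>
    ψ.hasFDerivAt.comp_hasDerivAt z (hasDerivAt_exp_smul_const' x z)
  have hφ' : ∀ z : ℂ, HasDerivAt (fun z : ℂ => ψ (x * NormedSpace.exp (z • x)))
      (ψ (x * (x * NormedSpace.exp (z • x)))) z := fun z =>
    ψ.hasFDerivAt.comp_hasDerivAt z ((hasDerivAt_exp_smul_const' x z).const_mul x)
  obtain ⟨c, hc⟩ := exists_hasDerivAt_const_mul_of_exponential_growth
    (φ := fun z : ℂ => ψ (NormedSpace.exp (z • x))) (K := ‖ψ‖ * ‖(1 : A)‖ + ‖x‖ + 1)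
    (fun z => (hφ z).differentiableAt) (fun z => hne _ (isUnit_exp_of_complex _))
    (by simpa using h1) (by positivity) (fun z => by
      have e1 : ‖ψ‖ * ‖(1 : A)‖ ≤ Real.exp (‖ψ‖ * ‖(1 : A)‖) := by
        linarith [Real.add_one_le_exp (‖ψ‖ * ‖(1 : A)‖)]
      calc ‖ψ (NormedSpace.exp (z • x))‖ ≤ ‖ψ‖ * (‖(1 : A)‖ * Real.exp ‖z • x‖) :=
            ψ.le_opNorm_of_le (norm_exp_le_norm_one_mul _)
        _ = ‖ψ‖ * ‖(1 : A)‖ * Real.exp ‖z • x‖ := by ring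
        _ ≤ Real.exp (‖ψ‖ * ‖(1 : A)‖) * Real.exp ‖z • x‖ := by gcongr
        _ = Real.exp (‖ψ‖ * ‖(1 : A)‖ + ‖z‖ * ‖x‖) := by rw [Real.exp_add, norm_smul]
        _ ≤ _ := by
          have a1 : 0 ≤ ‖ψ‖ * ‖(1 : A)‖ := by positivity
          have a2 := norm_nonneg z
          have a3 := norm_nonneg x
          gcongr
          nlinarith [mul_nonneg a1 a2])
  have hcx : ∀ z : ℂ, ψ (x * NormedSpace.exp (z • x)) = c * ψ (NormedSpace.exp (z • x)) :=
    fun z => (hφ z).unique (hc z)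
  have hcx' := ((hφ' 0).congr_of_eventuallyEq (.of_forall fun z => (hcx z).symm)).unique
    ((hφ 0).const_mul c)
  have hc0 := hcx 0
  simp only [zero_smul, NormedSpace.exp_zero, mul_one, h1] at hcx' hc0
  rw [hcx', hc0]

theorem exists_ne_zero_mul_add_conj_mul_eq_zero {a b : ℂ} (h : ‖a‖ = ‖b‖) :
    ∃ c : ℂ, c ≠ 0 ∧ c * a + (starRingEnd ℂ) (c * b) = 0 := by
  by_cases ha : a = 0
  · have hb : b = 0 := by simpa [ha] using h.symm
    exact ⟨1, one_ne_zero, by simp [ha, hb]⟩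
  obtain ⟨c, hc⟩ := IsAlgClosed.exists_pow_nat_eq (-(starRingEnd ℂ) b / a) two_pos
  have hn : ‖c‖ = 1 := by
    have : ‖c‖ ^ 2 = 1 := by
      rw [← norm_pow, hc, norm_div, norm_neg, RCLike.norm_conj, h, div_self]
      rw [← h]
      exact norm_ne_zero_iff.2 ha
    nlinarith [norm_nonneg c]
  have hcc : c * (starRingEnd ℂ) c = 1 := by simp [Complex.mul_conj', hn]
  refine ⟨c, by rintro rfl; simp at hn, ?_⟩
  rw [eq_div_iff ha] at hc
  rw [map_mul]
  linear_combination (starRingEnd ℂ) c * hc - c * a * hcc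

/-- A real-linear functional that fixes scalars and does not vanish on invertible elements is
complex-linear. -/
theorem map_I_smul_of_ne_zero_of_isUnit (ψ : A →L[ℝ] ℂ) (hψ : ∀ c : ℂ, ψ (c • 1) = c)
    (hne : ∀ x, IsUnit x → ψ x ≠ 0) (x : A) : ψ (Complex.I • x) = Complex.I * ψ x := by
  set J : A →L[ℝ] A := (Complex.I • ContinuousLinearMap.id ℂ A).restrictScalars ℝ with hJ
  have hJx : ∀ x, J x = Complex.I • x := fun x => rfl
  have hII : ∀ x : A, Complex.I • Complex.I • x = -x := fun x => by
    rw [smul_smul, Complex.I_mul_I, neg_one_smul]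
  obtain ⟨P, hP⟩ := exists_complexLinear_of_map_I_smul
    ((1 / 2 : ℂ) • (ψ - Complex.I • ψ.comp J)) (fun x => by
      simp only [smul_apply, sub_apply,
        ContinuousLinearMap.comp_apply, hJx, hII, map_neg, smul_eq_mul]
      linear_combination (1 / 2 * ψ (Complex.I • x)) * Complex.I_mul_I)
  obtain ⟨Q, hQ⟩ := exists_complexLinear_of_map_I_smul
    ((Complex.conjCLE : ℂ →L[ℝ] ℂ).comp ((1 / 2 : ℂ) • (ψ + Complex.I • ψ.comp J))) (fun x => by
      simp only [smul_apply, add_apply,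
        ContinuousLinearMap.comp_apply, hJx, hII, map_neg, smul_eq_mul,
        ContinuousLinearEquiv.coe_coe, Complex.conjCLE_apply, map_mul, map_add, Complex.conj_I]
      linear_combination ((starRingEnd ℂ) (1 / 2) * (starRingEnd ℂ) (ψ (Complex.I • x))) *
        Complex.I_mul_I)
  simp only [smul_apply, add_apply,
    sub_apply, ContinuousLinearMap.comp_apply, hJx, smul_eq_mul,
    ContinuousLinearEquiv.coe_coe, Complex.conjCLE_apply] at hP hQ
  have hψPQ : ∀ x, ψ x = P x + (starRingEnd ℂ) (Q x) := by
    intro x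
    rw [hP, hQ, Complex.conj_conj]
    ring
  have hQ1 : Q 1 = 0 := by
    have := hψ 1
    rw [one_smul] at this
    rw [hQ, hψ, this]
    simp
  have hP1 : P 1 = 1 := by
    have := hψ 1
    rwa [one_smul, hψPQ, hQ1, map_zero, add_zero] at this
  have hnorm : ∀ u, IsUnit u → ‖P u‖ ≠ ‖Q u‖ := by
    intro u hu h
    obtain ⟨c, hc, hc0⟩ := exists_ne_zero_mul_add_conj_mul_eq_zero h
    refine hne (c • u) (hu.smul (Units.mk0 c hc)) ?_
    rw [hψPQ, map_smul, map_smul]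
    exact hc0
  have hdiff : ∀ R : A →L[ℂ] ℂ, Differentiable ℂ (fun z : ℂ => R (NormedSpace.exp (z • x))) :=
    fun R z => (R.hasFDerivAt.comp_hasDerivAt z (hasDerivAt_exp_smul_const' x z)).differentiableAt
  have hlt : ∀ z : ℂ, ‖Q (NormedSpace.exp (z • x))‖ < ‖P (NormedSpace.exp (z • x))‖ := by
    intro z
    by_contra! hle
    obtain ⟨w, hw⟩ := mem_range_of_exists_le_of_exists_ge
      ((hdiff P).continuous.norm.sub (hdiff Q).continuous.norm) (c := 0)
      ⟨z, by simpa using hle⟩ ⟨0, by simp [hP1, hQ1]⟩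
    exact hnorm _ (isUnit_exp_of_complex _) (sub_eq_zero.1 hw)
  have hPne : ∀ z : ℂ, P (NormedSpace.exp (z • x)) ≠ 0 := fun z =>
    norm_pos_iff.1 ((norm_nonneg _).trans_lt (hlt z))
  have hQ0 : ∀ z : ℂ, Q (NormedSpace.exp (z • x)) = 0 := by
    intro z
    have h := (show Differentiable ℂ fun z : ℂ =>
        Q (NormedSpace.exp (z • x)) / P (NormedSpace.exp (z • x)) from
      (hdiff Q).div (hdiff P) hPne).apply_eq_apply_of_bounded
      (isBounded_iff_forall_norm_le.2 ⟨1, by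
        rintro _ ⟨w, rfl⟩
        rw [norm_div]
        exact div_le_one_of_le₀ (hlt w).le (norm_nonneg _)⟩) z 0
    simpa [hQ1, hPne z] using h
  have hQx : Q x = 0 := by
    have h := Q.hasFDerivAt.comp_hasDerivAt (0 : ℂ) (hasDerivAt_exp_smul_const' x (0 : ℂ))
    have h' := (h.congr_of_eventuallyEq (.of_forall fun z => (hQ0 z).symm)).unique
      (hasDerivAt_const (0 : ℂ) (0 : ℂ))
    simpa using h'
  rw [hψPQ, hψPQ x, map_smul, map_smul, hQx]
  simp

theorem norm_apply_sub_one_le {f : A → ℂ} (hspec : ∀ x, f x ∈ spectrum ℂ x) (x : A) :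
    ‖f x - 1‖ ≤ ‖x - 1‖ * ‖(1 : A)‖ := by
  apply spectrum.norm_le_norm_mul_of_mem
  have h := spectrum.sub_singleton_eq x (1 : ℂ)
  rw [map_one] at h
  rw [← h]
  exact Set.sub_mem_sub (hspec x) rfl

theorem exp_add_smul_of_complex (a b : ℂ) (x : A) : NormedSpace.exp ((a + b) • x) =
    NormedSpace.exp (a • x) * NormedSpace.exp (b • x) := by
  let _ := NormedAlgebra.restrictScalars ℚ ℂ A
  rw [add_smul]
  exact NormedSpace.exp_add_of_commute (((Commute.refl x).smul_left a).smul_right b)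

/-- A multiplicative spectral-valued functional is, on exponentials, the exponential of a
real-linear functional that does not vanish on invertible elements. -/
theorem exists_realLinear_apply_exp {f : A → ℂ} (hspec : ∀ x : A, f x ∈ spectrum ℂ x)
    (hmul : ∀ x y : A, f (x * y) = f x * f y) :
    ∃ ψ : A →L[ℝ] ℂ, (∀ x, f (NormedSpace.exp x) = Complex.exp (ψ x)) ∧
      (∀ c : ℂ, ψ (c • 1) = c) ∧ ∀ x, IsUnit x → ψ x ≠ 0 := by
  have hf1 : f 1 = 1 := by simpa using apply_smul_one_of_mem_spectrum hspec 1
  have hadd : ∀ x : A, ∀ s t : ℝ, f (NormedSpace.exp (((s + t : ℝ) : ℂ) • x)) =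
      f (NormedSpace.exp ((s : ℂ) • x)) * f (NormedSpace.exp ((t : ℂ) • x)) := by
    intro x s t
    rw [Complex.ofReal_add, exp_add_smul_of_complex, hmul]
  have hdiff : ∀ x : A, Differentiable ℂ fun z : ℂ => NormedSpace.exp (z • x) :=
    fun x z => (hasDerivAt_exp_smul_const' x z).differentiableAt
  have hcont : ∀ x : A, Continuous fun t : ℝ => f (NormedSpace.exp ((t : ℂ) • x)) := by
    intro x
    have h0 : Tendsto (fun t : ℝ => f (NormedSpace.exp ((t : ℂ) • x))) (𝓝 0) (𝓝 1) := by
      rw [tendsto_iff_norm_sub_tendsto_zero]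
      have hc : Continuous fun t : ℝ => ‖NormedSpace.exp ((t : ℂ) • x) - 1‖ * ‖(1 : A)‖ :=
        (((hdiff x).continuous.comp Complex.continuous_ofReal).sub continuous_const).norm.mul
          continuous_const
      exact squeeze_zero (fun t => norm_nonneg _) (fun t => norm_apply_sub_one_le hspec _)
        (by simpa using hc.tendsto 0)
    refine continuous_iff_continuousAt.2 fun t => ?_
    have h1 : Tendsto (fun s : ℝ => f (NormedSpace.exp (((s - t : ℝ) : ℂ) • x))) (𝓝 t) (𝓝 1) :=
      h0.comp (by simpa using (continuous_sub_right t).tendsto t)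
    have h2 := h1.const_mul (f (NormedSpace.exp ((t : ℂ) • x)))
    simp only [← hadd, add_sub_cancel, mul_one] at h2
    exact h2
  choose ψ hψ using fun x : A => exists_eq_exp_of_continuous_of_map_add (hcont x)
    (by simpa using hf1) (hadd x)
  have hψadd : ∀ x y, ψ (x + y) = ψ x + ψ y := by
    intro x y
    have hγ : HasDerivAt (fun z : ℂ => NormedSpace.exp (z • -(x + y)) *
        (NormedSpace.exp (z • x) * NormedSpace.exp (z • y))) 0 0 := by
      convert! (hasDerivAt_exp_smul_const' (-(x + y)) (0 : ℂ)).mul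
        ((hasDerivAt_exp_smul_const' x (0 : ℂ)).mul (hasDerivAt_exp_smul_const' y (0 : ℂ))) using 1
      simp
    have h1 := eq_zero_of_norm_cexp_sub_one_le (c := ψ x + ψ y - ψ (x + y)) hγ (by simp)
      (D := ‖(1 : A)‖) (fun t => by
        refine le_of_eq_of_le ?_ (norm_apply_sub_one_le hspec _)
        have e : f (NormedSpace.exp ((t : ℂ) • -(x + y))) = Complex.exp (-(t * ψ (x + y))) := by
          have h := hψ (x + y) (-t)
          rwa [Complex.ofReal_neg, neg_smul, ← smul_neg, neg_mul] at h
        rw [hmul, hmul, e, hψ, hψ, ← Complex.exp_add, ← Complex.exp_add]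
        congr 3
        ring)
    linear_combination -h1
  have hψsmul : ∀ (r : ℝ) x, ψ (r • x) = r • ψ x := by
    intro r x
    refine eq_of_forall_cexp_ofReal_mul_eq fun t => ?_
    rw [← hψ, ← Complex.coe_smul, smul_smul, ← Complex.ofReal_mul, hψ, Complex.real_smul,
      Complex.ofReal_mul, mul_assoc]
  have hψone : ∀ c : ℂ, ψ (c • 1) = c := by
    intro c
    refine eq_of_forall_cexp_ofReal_mul_eq fun t => ?_
    rw [← hψ, smul_smul, ← Algebra.algebraMap_eq_smul_one, ← NormedSpace.algebraMap_exp_comm,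
      Algebra.algebraMap_eq_smul_one, apply_smul_one_of_mem_spectrum hspec, Complex.exp_eq_exp_ℂ]
  have hψne : ∀ x, IsUnit x → ψ x ≠ 0 := by
    intro x hx h0
    have hnu : ∀ t : ℝ, ¬ IsUnit (NormedSpace.exp ((t : ℂ) • x) - 1) := by
      intro t
      have h := hspec (NormedSpace.exp ((t : ℂ) • x))
      rw [hψ, h0, mul_zero, Complex.exp_zero, spectrum.mem_iff, map_one, IsUnit.sub_iff] at h
      exact h
    have hd : HasDerivAt (fun z : ℂ => NormedSpace.exp (z • x)) x 0 := by
      simpa using hasDerivAt_exp_smul_const' x (0 : ℂ)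
    have hs := hd.tendsto_slope_zero
    have hopen := hs.eventually (Units.isOpen.mem_nhds hx)
    have hofR : Tendsto (fun t : ℝ => (t : ℂ)) (𝓝[≠] 0) (𝓝[≠] 0) :=
      tendsto_nhdsWithin_iff.2 ⟨(by simpa using Complex.continuous_ofReal.tendsto 0 :
        Tendsto (fun t : ℝ => (t : ℂ)) (𝓝 0) (𝓝 0)).mono_left nhdsWithin_le_nhds,
        eventually_mem_nhdsWithin.mono fun t ht => by simpa using ht⟩
    obtain ⟨t, ht, ht0⟩ := ((hofR.eventually hopen).and eventually_mem_nhdsWithin).exists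
    have ht0' : (t : ℂ) ≠ 0 := by simpa using ht0
    simp only [zero_add, zero_smul, NormedSpace.exp_zero] at ht
    refine hnu t ?_
    have h := IsUnit.smul (Units.mk0 (t : ℂ) ht0') ht
    rwa [Units.smul_def, Units.val_mk0, smul_smul, mul_inv_cancel₀ ht0', one_smul] at h
  have hψmem : ∀ x, ψ x ∈ spectrum ℂ x := by
    intro x
    rw [spectrum.mem_iff, Algebra.algebraMap_eq_smul_one]
    intro h
    refine hψne _ h ?_
    have e := hψadd (ψ x • 1 - x) x
    rw [sub_add_cancel, hψone] at e
    linear_combination -e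
  refine ⟨LinearMap.mkContinuous ⟨⟨ψ, hψadd⟩, hψsmul⟩ ‖(1 : A)‖ fun x => ?_, fun x => ?_,
    hψone, hψne⟩
  · rw [mul_comm]
    exact spectrum.norm_le_norm_mul_of_mem (hψmem x)
  · simpa using hψ x 1

theorem ball_one_subset_connectedComponentIn_isUnit :
    Metric.ball (1 : A) 1 ⊆ connectedComponentIn {x : A | IsUnit x} 1 := by
  refine (convex_ball (1 : A) 1).isPreconnected.subset_connectedComponentIn
    (Metric.mem_ball_self one_pos) fun x hx => ?_
  have h : ‖1 - x‖ < 1 := by rwa [norm_sub_rev, ← dist_eq_norm]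
  simpa using isUnit_one_sub_of_norm_lt_one h

/-- Two multiplicative functionals that do not vanish on invertible elements and agree near `1`
agree on the connected component of `1` in the invertible elements. -/
theorem eqOn_connectedComponentIn_of_eventuallyEq {R : Type*} [NormedRing R] [CompleteSpace R]
    {f g : R → ℂ}
    (hf : ∀ x y, f (x * y) = f x * f y) (hg : ∀ x y, g (x * y) = g x * g y)
    (hg0 : ∀ x, IsUnit x → g x ≠ 0) (h : f =ᶠ[𝓝 1] g) :
    Set.EqOn f g (connectedComponentIn {x : R | IsUnit x} 1) := by
  have hmove : ∀ x : R, IsUnit x → ∀ᶠ y in 𝓝 x, (f y = g y ↔ f x = g x) := by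
    rintro _ ⟨u, rfl⟩
    have ht : Tendsto (fun y : R => (↑u⁻¹ : R) * y) (𝓝 u) (𝓝 1) := by
      simpa using (continuous_const_mul (↑u⁻¹ : R)).tendsto (u : R)
    filter_upwards [ht.eventually h, ht.eventually (Units.isOpen.mem_nhds isUnit_one)] with y hy hyu
    have e : y = u * (↑u⁻¹ * y) := by simp
    rw [e, hf, hg, hy]
    exact mul_left_inj' (hg0 _ hyu)
  have hopen : ∀ P : Prop, IsOpen {x : R | IsUnit x ∧ ((f x = g x) ↔ P)} := by
    intro P
    refine isOpen_iff_mem_nhds.2 fun x hx => ?_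
    filter_upwards [hmove x hx.1, Units.isOpen.mem_nhds hx.1] with y hy hyu
    exact ⟨hyu, hy.trans hx.2⟩
  have h1u : (1 : R) ∈ {x : R | IsUnit x} := isUnit_one
  intro x hx
  have hsub := connectedComponentIn_subset {x : R | IsUnit x} 1
  by_contra hne
  obtain ⟨y, -, hy1, hy2⟩ := isPreconnected_connectedComponentIn _ _ (hopen True) (hopen False)
    (fun y hy => by
      by_cases hfg : f y = g y
      · exact Or.inl ⟨hsub hy, by simp [hfg]⟩
      · exact Or.inr ⟨hsub hy, by simp [hfg]⟩)
    ⟨1, mem_connectedComponentIn h1u, isUnit_one, by simp [h.eq_of_nhds]⟩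
    ⟨x, hx, hsub hx, by simp [hne]⟩
  exact hy2.2.1 (hy1.2.2 trivial)

/-- A multiplicative linear functional intertwines the exponentials. -/
theorem apply_exp_of_map_mul (ψ : A →L[ℂ] ℂ) (h1 : ψ 1 = 1)
    (hmul : ∀ x y, ψ (x * y) = ψ x * ψ y) (x : A) :
    ψ (NormedSpace.exp x) = Complex.exp (ψ x) := by
  let Ψ : A →ₐ[ℂ] ℂ := AlgHom.ofLinearMap ψ.toLinearMap h1 hmul
  let _ := NormedAlgebra.restrictScalars ℚ ℂ A
  rw [Complex.exp_eq_exp_ℂ]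
  exact NormedSpace.map_exp Ψ ψ.continuous x

theorem apply_eq_of_eqOn_ball {E : Type*} [NormedAddCommGroup E] [NormedSpace ℂ E]
    {φ ψ : E →ₗ[ℂ] ℂ} {a : E} {r : ℝ} (hr : 0 < r)
    (h : Set.EqOn φ ψ (Metric.ball a r)) : φ = ψ := by
  ext x
  have ht : Tendsto (fun z : ℂ => a + z • x) (𝓝[≠] 0) (𝓝 a) := by
    have hc : Continuous fun z : ℂ => a + z • x := by fun_prop
    have := hc.tendsto 0
    rw [zero_smul, add_zero] at this
    exact this.mono_left nhdsWithin_le_nhds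
  obtain ⟨z, hz, hz0⟩ :=
    ((ht.eventually (Metric.ball_mem_nhds a hr)).and eventually_mem_nhdsWithin).exists
  have h1 := h hz
  rw [map_add, map_add, h (Metric.mem_ball_self hr), map_smul, map_smul] at h1
  exact smul_right_injective ℂ (show z ≠ 0 from hz0) (add_left_cancel h1)

end

/-- Maouche's theorem (Theorem 1.2): a (not necessarily linear) multiplicative
spectral-valued functional on a unital complex Banach algebra agrees with a
unique multiplicative linear functional on the principal component of the
invertible elements. -/
theorem maouche_theorem
    {A : Type*} [NormedRing A] [NormedAlgebra ℂ A] [CompleteSpace A]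
    (f : A → ℂ) (hspec : ∀ x : A, f x ∈ spectrum ℂ x)
    (hmul : ∀ x y : A, f (x * y) = f x * f y) :
    ∃! ψ : A →ₗ[ℂ] ℂ,
      (∀ x y : A, ψ (x * y) = ψ x * ψ y) ∧
      ∀ x ∈ connectedComponentIn {x : A | IsUnit x} 1, ψ x = f x := by

  obtain ⟨ψr, hexp, hone, hne⟩ := exists_realLinear_apply_exp hspec hmul
  obtain ⟨ψ, hψ⟩ := exists_complexLinear_of_map_I_smul ψr
    (map_I_smul_of_ne_zero_of_isUnit ψr hone hne)
  simp only [← hψ] at hexp hone hne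
  have hψ1 : ψ 1 = 1 := by simpa using hone 1
  have hψmul := map_mul_of_ne_zero_of_isUnit ψ hψ1 hne
  have hnear : f =ᶠ[𝓝 1] ψ := by
    have hmap : Filter.map (NormedSpace.exp : A → A) (𝓝 0) = 𝓝 1 := by
      have h : HasStrictFDerivAt (NormedSpace.exp : A → A)
          ((ContinuousLinearEquiv.refl ℂ A : A ≃L[ℂ] A) : A →L[ℂ] A) 0 :=
        hasStrictFDerivAt_exp_zero
      simpa using h.map_nhds_eq_of_equiv
    rw [← hmap]
    exact Filter.eventually_map.2 (.of_forall fun x => by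
      rw [hexp, apply_exp_of_map_mul ψ hψ1 hψmul])
  have heq := eqOn_connectedComponentIn_of_eventuallyEq hmul hψmul hne hnear
  refine ⟨ψ.toLinearMap, ⟨hψmul, fun x hx => (heq hx).symm⟩, fun φ hφ => ?_⟩
  exact apply_eq_of_eqOn_ball one_pos fun x hx =>
    (hφ.2 x (ball_one_subset_connectedComponentIn_isUnit hx)).trans
      (heq (ball_one_subset_connectedComponentIn_isUnit hx))
end

section
/- Let A be a unital complex Banach algebra and let f : A → ℂ be a (not necessarily linear) functional satisfying: (a) f(x·y·x) = f(x)²·f(y) for all x, y ∈ A; (b) f(x) ∈ σ(x) for all x ∈ A. Then there exists a unique continuous ℂ-linear functional ψ : A → ℂ with ψ((xy+yx)/2) = ψ(x)·ψ(y) for all x, y ∈ A such that f(x) = ψ(x) for every x in the connected component of 1 in the set of invertible elements of A. -/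
theorem Multiset.sum_sq_eq_sum_map_sq_add_two_mul_esymm {R : Type*} [CommRing R]
    (s : Multiset R) : s.sum ^ 2 = (s.map (· ^ 2)).sum + 2 * s.esymm 2 := by
  induction s using Multiset.induction_on with
  | empty => simp [Multiset.esymm, Multiset.powersetCard_zero_right]
  | cons a s ih =>
    have h : (a ::ₘ s).esymm 2 = s.esymm 2 + a * s.sum := by
      simpa [Multiset.esymm, Multiset.powersetCard_one] using
        Multiset.sum_map_mul_left (s := s) (a := a) (f := id)
    rw [h, Multiset.sum_cons, Multiset.map_cons, Multiset.sum_cons]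
    linear_combination ih

section Spectral

variable {A : Type*} [NormedRing A] [NormedAlgebra ℂ A] [CompleteSpace A]

open Polynomial in
theorem exists_multiset_of_ne_zero_on_isUnit {A : Type*} [Ring A] [Algebra ℂ A]
    (L : A →ₗ[ℂ] ℂ) (h1 : L 1 = 1)
    (hL : ∀ u, IsUnit u → L u ≠ 0) (x : A) (m : ℕ) :
    ∃ s : Multiset ℂ, s.card = m + 2 ∧ (∀ z ∈ s, z ∈ spectrum ℂ x) ∧
      s.sum = (m + 2) * L x ∧ 2 * s.esymm 2 = (m + 2) * (m + 1) * L (x ^ 2) := by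
  set c : ℕ → ℂ := fun k => L ((-x) ^ (m + 2 - k)) * (m + 2).choose k with hc
  set p : ℂ[X] := ∑ k ∈ Finset.range (m + 3), C (c k) * X ^ k with hp
  have hcoeff (k : ℕ) (hk : k < m + 3) : p.coeff k = c k := by
    simp [hp, finsetSum_coeff, hk]
  have hdeg : p.natDegree ≤ m + 2 := by
    refine natDegree_sum_le_of_forall_le _ _ fun k hk => ?_
    exact (natDegree_C_mul_X_pow_le _ _).trans (by simp at hk; omega)
  have hmonic : p.Monic := monic_of_natDegree_le_of_coeff_eq_one (m + 2) hdeg (by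
    rw [hcoeff _ (by omega)]; simp [hc, h1])
  have hnat : p.natDegree = m + 2 := by
    refine le_antisymm hdeg (le_natDegree_of_ne_zero ?_)
    rw [hcoeff _ (by omega)]; simp [hc, h1]
  have heval (z : ℂ) : p.eval z = L ((algebraMap ℂ A z - x) ^ (m + 2)) := by
    rw [sub_eq_add_neg, (Algebra.commute_algebraMap_left z (-x)).add_pow, map_sum, hp,
      eval_finsetSum]
    refine Finset.sum_congr rfl fun k _ => ?_
    rw [← map_pow, ← Nat.cast_comm, ← nsmul_eq_mul, map_nsmul, ← Algebra.smul_def, map_smul]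
    simp [hc]
    ring
  have hcard : p.roots.card = p.natDegree :=
    splits_iff_card_roots.mp (IsAlgClosed.splits p)
  refine ⟨p.roots, hcard.trans hnat, fun z hz => ?_, ?_, ?_⟩
  · have h0 : p.eval z = 0 := (mem_roots hmonic.ne_zero).mp hz
    rw [spectrum.mem_iff]
    intro hu
    exact hL _ (hu.pow (m + 2)) (heval z ▸ h0)
  · have := coeff_eq_esymm_roots_of_card hcard (k := m + 1) (by omega)
    rw [hcoeff _ (by omega), hmonic.leadingCoeff, hnat] at this
    simp [hc, show m + 2 - (m + 1) = 1 by omega, Multiset.esymm, Multiset.powersetCard_one] at this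
    linear_combination -this
  · have := coeff_eq_esymm_roots_of_card hcard (k := m) (by omega)
    rw [hcoeff _ (by omega), hmonic.leadingCoeff, hnat] at this
    simp only [hc, show m + 2 - m = 2 by omega, neg_sq, one_mul, even_two.neg_one_pow] at this
    rw [← this, Nat.choose_symm_add, Nat.cast_choose_two]
    push_cast; ring

theorem map_sq_of_ne_zero_on_isUnit
    (L : A →ₗ[ℂ] ℂ) (h1 : L 1 = 1) (hL : ∀ u, IsUnit u → L u ≠ 0) (x : A) :
    L (x ^ 2) = L x ^ 2 := by
  by_contra hne
  have hpos : 0 < ‖L x ^ 2 - L (x ^ 2)‖ := norm_pos_iff.mpr (sub_ne_zero.mpr (Ne.symm hne))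
  set R := ‖x‖ * ‖(1 : A)‖
  obtain ⟨m, hm⟩ := exists_nat_gt ((R ^ 2 + ‖L (x ^ 2)‖) / ‖L x ^ 2 - L (x ^ 2)‖)
  rw [div_lt_iff₀ hpos] at hm
  obtain ⟨s, hcard, hs, hsum, hesymm⟩ := exists_multiset_of_ne_zero_on_isUnit L h1 hL x m
  have hsq := s.sum_sq_eq_sum_map_sq_add_two_mul_esymm
  rw [hsum, hesymm] at hsq
  have hbound : ‖(s.map (· ^ 2)).sum‖ ≤ (m + 2) * R ^ 2 := by
    have h2 : (s.map (‖· ^ 2‖)).sum ≤ s.card • R ^ 2 := by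
      rw [← Multiset.card_map (‖· ^ 2‖) s]
      refine Multiset.sum_le_card_nsmul _ _ fun r hr => ?_
      obtain ⟨z, hz, rfl⟩ := Multiset.mem_map.mp hr
      rw [norm_pow]
      exact pow_le_pow_left₀ (norm_nonneg _) (spectrum.norm_le_norm_mul_of_mem (hs z hz)) 2
    rw [hcard, nsmul_eq_mul] at h2
    push_cast at h2
    refine le_trans ?_ h2
    simpa only [Multiset.map_map, Function.comp_def] using
      norm_multiset_sum_le (s.map (· ^ 2))
  have key : (m + 2 : ℂ) * ((m + 2) * (L x ^ 2 - L (x ^ 2))) =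
      (s.map (· ^ 2)).sum - (m + 2) * L (x ^ 2) := by
    linear_combination hsq
  have hn : ‖(m + 2 : ℂ)‖ = m + 2 := by exact_mod_cast Complex.norm_natCast (m + 2)
  have hle : (m + 2 : ℝ) * ((m + 2) * ‖L x ^ 2 - L (x ^ 2)‖) ≤
      (m + 2) * (R ^ 2 + ‖L (x ^ 2)‖) := by
    rw [← hn, ← norm_mul, ← norm_mul, key, mul_add, hn]
    refine (norm_sub_le _ _).trans ?_
    rw [norm_mul, hn]
    gcongr
  have := le_of_mul_le_mul_left hle (by positivity)
  nlinarith

open Complex in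
/-- A continuous real-linear functional commuting with multiplication by `I` is complex-linear. -/
noncomputable def ContinuousLinearMap.complexOfMapI {E : Type*} [NormedAddCommGroup E] [NormedSpace ℂ E]
    (M : E →L[ℝ] ℂ) (h : ∀ x, M (I • x) = I * M x) : E →L[ℂ] ℂ where
  toFun := M
  map_add' := map_add M
  map_smul' c x := by
    have hx : c • x = c.re • x + c.im • (I • x) := by
      rw [← Complex.coe_smul, ← Complex.coe_smul, smul_smul, ← add_smul, re_add_im]
    rw [hx, map_add, map_smul, map_smul, h, RingHom.id_apply, smul_eq_mul, real_smul, real_smul]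
    nth_rewrite 3 [← re_add_im c]
    ring
  cont := M.continuous

open Complex ComplexConjugate in
theorem map_I_smul_of_mem_spectrum [Nontrivial A] (L : A →L[ℝ] ℂ)
    (hL : ∀ x, L x ∈ spectrum ℂ x) (x : A) : L (I • x) = I * L x := by
  have hone (c : ℂ) : L (c • (1 : A)) = c := by
    simpa [← Algebra.algebraMap_eq_smul_one] using hL (c • 1)
  have hsmul (c : ℂ) (y : A) : L (c • y) = c.re * L y + c.im * L (I • y) := by
    have hy : c • y = c.re • y + c.im • (I • y) := by
      rw [← Complex.coe_smul, ← Complex.coe_smul, smul_smul, ← add_smul, re_add_im]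
    rw [hy, map_add, map_smul, map_smul, real_smul, real_smul]
  have hII (y : A) : I • I • y = -y := by simp [smul_smul]
  let J : A →L[ℝ] A := I • ContinuousLinearMap.id ℝ A
  let h : A →L[ℂ] ℂ := (L - I • L.comp J).complexOfMapI fun y => by
    simp [J, hII]
    linear_combination L (I • y) * I_mul_I
  let k : A →L[ℂ] ℂ := (conjCLE.toContinuousLinearMap.comp (L + I • L.comp J)).complexOfMapI
    fun y => by
      simp [J, hII]
      linear_combination conj (L (I • y)) * I_mul_I
  have happ (y : A) : h y = L y - I * L (I • y) := rfl
  have kapp (y : A) : k y = conj (L y + I * L (I • y)) := rfl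
  have hne (u : A) (hu : IsUnit u) : ‖h u‖ - ‖k u‖ ≠ 0 := by
    intro heq
    obtain ⟨w, hw, hzero⟩ : ∃ w : ℂ, w ≠ 0 ∧ w * h u + conj w * conj (k u) = 0 := by
      by_cases h0 : h u = 0
      · have k0 : k u = 0 := by simpa [h0] using heq
        exact ⟨1, one_ne_zero, by simp [h0, k0]⟩
      · obtain ⟨w, hw⟩ := IsAlgClosed.exists_pow_nat_eq (-conj (k u) / h u) two_pos
        have hnorm : ‖w‖ = 1 := by
          have : ‖w‖ ^ 2 = 1 := by
            rw [← norm_pow, hw, norm_div, norm_neg, RCLike.norm_conj, ← sub_eq_zero.mp heq,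
              div_self (norm_ne_zero_iff.mpr h0)]
          exact (pow_eq_one_iff_of_nonneg (norm_nonneg w) two_ne_zero).mp this
        have hconj : w * conj w = 1 := by rw [mul_conj, normSq_eq_norm_sq, hnorm]; simp
        refine ⟨w, norm_ne_zero_iff.mp (by simp [hnorm]), ?_⟩
        rw [eq_div_iff h0] at hw
        linear_combination conj w * hw - w * h u * hconj
    have hLw : L (w • u) = 0 := by
      rw [happ, kapp, conj_conj] at hzero
      rw [hsmul]
      have h1 := re_add_im w
      have h2 : conj w = w.re - w.im * I := by
        apply Complex.ext <;> simp
      rw [h2] at hzero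
      nth_rewrite 1 [← h1] at hzero
      linear_combination hzero / 2 + w.im * L (I • u) * I_mul_I
    have := hL (w • u)
    rw [hLw, spectrum.zero_mem_iff] at this
    exact this ((hu.smul (Units.mk0 w hw)))
  let e : ℂ → A := fun z => NormedSpace.exp (z • x)
  have he : Differentiable ℂ e := fun z => (hasDerivAt_exp_smul_const x z).differentiableAt
  have he0 : e 0 = 1 := by simp [e]
  have hunit (z : ℂ) : IsUnit (e z) := by
    let : NormedAlgebra ℚ A := NormedAlgebra.restrictScalars ℚ ℂ A
    exact NormedSpace.isUnit_exp _
  have h1 : h 1 = 2 := by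
    have h1 := hone 1
    rw [one_smul] at h1
    rw [happ, hone, h1, I_mul_I]
    norm_num
  have k1 : k 1 = 0 := by
    have h1 := hone 1
    rw [one_smul] at h1
    rw [kapp, hone, h1, I_mul_I]
    simp
  have hlt (z : ℂ) : ‖k (e z)‖ < ‖h (e z)‖ := by
    by_contra! hle
    have hcont : Continuous fun z => ‖h (e z)‖ - ‖k (e z)‖ := by
      have := he.continuous
      fun_prop
    obtain ⟨w, hw⟩ := mem_range_of_exists_le_of_exists_ge hcont (c := 0)
      ⟨z, by simpa using hle⟩ ⟨0, by simp [he0, h1, k1]⟩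
    exact hne _ (hunit w) hw
  have hpos (z : ℂ) : h (e z) ≠ 0 := norm_pos_iff.mp ((norm_nonneg _).trans_lt (hlt z))
  have hdiff : Differentiable ℂ fun z => k (e z) / h (e z) :=
    (k.differentiable.comp he).div (h.differentiable.comp he) hpos
  have hbdd : Bornology.IsBounded (Set.range fun z => k (e z) / h (e z)) := by
    refine isBounded_iff_forall_norm_le.mpr ⟨1, ?_⟩
    rintro _ ⟨z, rfl⟩
    simp only [norm_div]
    exact div_le_one_of_le₀ (hlt z).le (norm_nonneg _)
  have hk0 (z : ℂ) : k (e z) = 0 := by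
    have := hdiff.apply_eq_apply_of_bounded hbdd z 0
    simpa [he0, k1, hpos z] using this
  have hder : HasDerivAt (fun z => k (e z)) (k x) 0 := by
    have := k.hasFDerivAt.comp_hasDerivAt (0 : ℂ) (hasDerivAt_exp_smul_const x (0 : ℂ))
    simpa [Function.comp_def] using this
  have hkx : k x = 0 := by
    simp only [hk0] at hder
    exact hder.unique (hasDerivAt_const 0 0)
  rw [kapp, map_eq_zero] at hkx
  linear_combination (-I) * hkx + L (I • x) * I_mul_I

open NormedSpace Filter Topology

theorem exp_add_of_commute_complex {x y : A} (h : Commute x y) :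
    exp (x + y) = exp x * exp y := by
  let : NormedAlgebra ℚ A := NormedAlgebra.restrictScalars ℚ ℂ A
  exact exp_add_of_commute h

theorem exp_half_smul_mul_self (x : A) : exp ((2⁻¹ : ℂ) • x) * exp ((2⁻¹ : ℂ) • x) = exp x := by
  rw [← exp_add_of_commute_complex (Commute.refl _), ← add_smul]
  norm_num

theorem exp_mul_exp_neg_complex (x : A) : exp x * exp (-x) = 1 := by
  rw [← exp_add_of_commute_complex (Commute.refl x).neg_right, add_neg_cancel, exp_zero]

theorem eventually_nhds_one_of_exp {P : A → Prop} (h : ∀ᶠ v in 𝓝 (0 : A), P (exp v)) :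
    ∀ᶠ w in 𝓝 (1 : A), P w := by
  have hs : HasStrictFDerivAt exp ((ContinuousLinearEquiv.refl ℂ A : A ≃L[ℂ] A) : A →L[ℂ] A) 0 :=
    hasStrictFDerivAt_exp_zero
  have := hs.map_nhds_eq_of_equiv
  rw [exp_zero] at this
  rwa [← this, eventually_map]

omit [NormedAlgebra ℂ A] [CompleteSpace A] in
theorem map_mul_map_inv_eq_one {g : A → ℂ} (hU : ∀ x y : A, g (x * y * x) = g x ^ 2 * g y)
    (h1 : g 1 = 1) (u : Aˣ) : g u * g ↑u⁻¹ = 1 := by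
  have h2 := hU ↑u⁻¹ (u * u)
  have h3 := hU u 1
  have h4 := hU u ↑u⁻¹
  simp only [mul_one, Units.inv_mul_cancel_left, Units.mul_inv, h1, one_mul] at h2 h3 h4
  have h0 : g u ≠ 0 := by
    intro h0
    rw [h3, h0] at h2
    simp at h2
  exact mul_left_cancel₀ h0 (by linear_combination -h4)

section

variable {f : A → ℂ} (hU : ∀ x y : A, f (x * y * x) = f x ^ 2 * f y)
  (hspec : ∀ x : A, f x ∈ spectrum ℂ x)

omit [CompleteSpace A] in
include hspec in
theorem nontrivial_of_mem_spectrum : Nontrivial A := by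
  by_contra h
  rw [not_nontrivial_iff_subsingleton] at h
  simpa [spectrum.of_subsingleton] using hspec 0

omit [CompleteSpace A] in
include hspec in
theorem map_one_of_mem_spectrum : f 1 = 1 := by
  have := nontrivial_of_mem_spectrum hspec
  simpa using hspec 1

omit [CompleteSpace A] in
include hU hspec in
theorem map_mul_self_of_mem_spectrum (x : A) : f (x * x) = f x ^ 2 := by
  simpa [map_one_of_mem_spectrum hspec] using hU x 1

include hspec in
theorem tendsto_one_of_mem_spectrum {ι : Type*} {l : Filter ι} {u : ι → A}
    (hu : Tendsto u l (𝓝 1)) : Tendsto (fun i => f (u i)) l (𝓝 1) := by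
  rw [tendsto_iff_norm_sub_tendsto_zero] at hu ⊢
  refine squeeze_zero (fun _ => norm_nonneg _) (fun i => ?_)
    (by simpa using hu.mul_const ‖(1 : A)‖)
  refine spectrum.norm_le_norm_mul_of_mem ?_
  rw [spectrum.mem_iff]
  have := hspec (u i)
  rw [spectrum.mem_iff] at this
  simpa using this

/-- `2⁻ⁿ * c` is a logarithm of `f (exp (2⁻ⁿ • x))` for all large `n`. -/
def IsDyadicLog (f : A → ℂ) (x : A) (c : ℂ) : Prop :=
  ∀ᶠ n : ℕ in atTop, f (exp ((2⁻¹ : ℂ) ^ n • x)) = Complex.exp (2⁻¹ ^ n * c)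

theorem tendsto_two_inv_pow : Tendsto (fun n : ℕ => (2⁻¹ : ℂ) ^ n) atTop (𝓝 0) :=
  tendsto_pow_atTop_nhds_zero_of_norm_lt_one (by norm_num)

theorem exp_two_inv_pow_succ_mul_self (x : A) (n : ℕ) :
    exp ((2⁻¹ : ℂ) ^ (n + 1) • x) * exp ((2⁻¹ : ℂ) ^ (n + 1) • x) = exp ((2⁻¹ : ℂ) ^ n • x) := by
  rw [← exp_half_smul_mul_self ((2⁻¹ : ℂ) ^ n • x), smul_smul, pow_succ']

include hU hspec in
theorem exists_isDyadicLog (x : A) : ∃ c, IsDyadicLog f x c := by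
  set a : ℕ → ℂ := fun n => f (exp ((2⁻¹ : ℂ) ^ n • x)) with ha
  have hsq (n : ℕ) : a (n + 1) ^ 2 = a n := by
    simp only [ha]
    rw [← map_mul_self_of_mem_spectrum hU hspec, exp_two_inv_pow_succ_mul_self]
  have hlim : Tendsto a atTop (𝓝 1) := by
    refine tendsto_one_of_mem_spectrum hspec ?_
    have hcont : Continuous fun t : ℂ => exp (t • x) :=
      (differentiable_exp_smul_const ℂ x).continuous
    simpa [Function.comp_def] using (hcont.tendsto 0).comp tendsto_two_inv_pow
  have hre : ∀ᶠ n in atTop, 0 < (a n).re :=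
    ((Complex.continuous_re.tendsto 1).comp hlim).eventually (lt_mem_nhds (by simp))
  obtain ⟨N, hN⟩ := eventually_atTop.mp hre
  have hne (n : ℕ) (hn : N ≤ n) : a n ≠ 0 := fun h => by simpa [h] using hN n hn
  have hlog (n : ℕ) (hn : N ≤ n) : Complex.log (a n) = 2⁻¹ ^ n * (2 ^ N * Complex.log (a N)) := by
    induction n, hn using Nat.le_induction with
    | base => rw [← mul_assoc, ← mul_pow]; norm_num
    | succ n hn ih =>
      have harg := abs_lt.mp
        (Complex.abs_arg_lt_pi_div_two_iff.mpr (Or.inl (hN (n + 1) (by omega))))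
      have : Complex.log (a n) = Complex.log (a (n + 1)) + Complex.log (a (n + 1)) := by
        rw [← hsq n, sq]
        exact Complex.log_mul (hne _ (by omega)) (hne _ (by omega))
          ⟨by linarith [harg.1], by linarith [harg.2]⟩
      rw [pow_succ]
      linear_combination ih / 2 - this / 2
  refine ⟨2 ^ N * Complex.log (a N), eventually_atTop.mpr ⟨N, fun n hn => ?_⟩⟩
  rw [← hlog n hn, Complex.exp_log (hne n hn)]

omit [CompleteSpace A] in
include hspec in
theorem isDyadicLog_zero : IsDyadicLog f 0 0 :=
  Eventually.of_forall fun n => by simp [map_one_of_mem_spectrum hspec]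

include hU hspec in
theorem IsDyadicLog.neg {x : A} {c : ℂ} (h : IsDyadicLog f x c) : IsDyadicLog f (-x) (-c) := by
  filter_upwards [h] with n hn
  have hx := exp_mul_exp_neg_complex ((2⁻¹ : ℂ) ^ n • x)
  have hx' := exp_mul_exp_neg_complex (-((2⁻¹ : ℂ) ^ n • x))
  rw [neg_neg] at hx'
  have := map_mul_map_inv_eq_one hU (map_one_of_mem_spectrum hspec) ⟨_, _, hx, hx'⟩
  simp only [Units.inv_mk] at this
  rw [smul_neg, mul_neg, Complex.exp_neg, ← hn]
  exact eq_inv_of_mul_eq_one_right this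

include hU hspec in
theorem IsDyadicLog.add_add_mem_spectrum {x y z : A} {a b c : ℂ} (hx : IsDyadicLog f x a)
    (hy : IsDyadicLog f y b) (hz : IsDyadicLog f z c) : a + b + c ∈ spectrum ℂ (x + y + z) := by
  rw [spectrum.mem_iff]
  intro hu
  let P : ℂ → A := fun t => algebraMap ℂ A (Complex.exp (t * (a + b + c))) -
    exp (t • (2⁻¹ : ℂ) • x) * (exp (t • (2⁻¹ : ℂ) • y) * exp (t • z) * exp (t • (2⁻¹ : ℂ) • y)) *
      exp (t • (2⁻¹ : ℂ) • x)
  have hP : HasDerivAt P (algebraMap ℂ A (a + b + c) - (x + y + z)) 0 := by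
    have e (w : A) : HasDerivAt (fun t : ℂ => exp (t • w)) w 0 := by
      simpa using hasDerivAt_exp_smul_const w (0 : ℂ)
    have e1 : HasDerivAt (fun t : ℂ => algebraMap ℂ A (Complex.exp (t * (a + b + c))))
        (algebraMap ℂ A (a + b + c)) 0 := by
      have := ((hasDerivAt_id (0 : ℂ)).mul_const (a + b + c)).cexp
      simpa [Algebra.algebraMap_eq_smul_one] using this.smul_const (1 : A)
    refine HasDerivAt.congr_deriv (f := P) (e1.sub (((e ((2⁻¹ : ℂ) • x)).mul (((e ((2⁻¹ : ℂ) • y)).mul (e z)).mul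
      (e ((2⁻¹ : ℂ) • y)))).mul (e ((2⁻¹ : ℂ) • x)))) ?_
    simp only [Pi.mul_apply, zero_smul, exp_zero, one_mul, mul_one]
    module
  have hP0 : P 0 = 0 := by simp [P]
  have hlim := hP.tendsto_slope_zero.comp (tendsto_nhdsWithin_iff.mpr
    ⟨tendsto_two_inv_pow, Eventually.of_forall fun n => by simp⟩)
  have hev := hlim.eventually (Units.isOpen.mem_nhds hu)
  obtain ⟨n, hn, hnx, hny, hnz⟩ := (hev.and (hx.and (hy.and hz))).exists
  simp only [Function.comp_apply, zero_add, hP0, sub_zero] at hn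
  have hunit : IsUnit (P (2⁻¹ ^ n)) :=
    (isUnit_smul_iff (Units.mk0 ((2⁻¹ : ℂ) ^ n)⁻¹ (by simp)) _).mp hn
  have hhalf (w : A) : f (exp ((2⁻¹ : ℂ) ^ n • (2⁻¹ : ℂ) • w)) ^ 2 =
      f (exp ((2⁻¹ : ℂ) ^ n • w)) := by
    rw [← map_mul_self_of_mem_spectrum hU hspec, smul_comm, exp_half_smul_mul_self]
  have hmem := hspec (exp ((2⁻¹ : ℂ) ^ n • (2⁻¹ : ℂ) • x) * (exp ((2⁻¹ : ℂ) ^ n • (2⁻¹ : ℂ) • y) *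
    exp ((2⁻¹ : ℂ) ^ n • z) * exp ((2⁻¹ : ℂ) ^ n • (2⁻¹ : ℂ) • y)) *
      exp ((2⁻¹ : ℂ) ^ n • (2⁻¹ : ℂ) • x))
  rw [hU, hU, hhalf, hhalf, hnx, hny, hnz, ← Complex.exp_add, ← Complex.exp_add, spectrum.mem_iff]
    at hmem
  refine hmem ?_
  convert hunit using 5
  ring

include hU hspec in
theorem exists_realLinear_log :
    ∃ L : A →L[ℝ] ℂ, (∀ x, L x ∈ spectrum ℂ x) ∧ ∀ x, f (exp x) = Complex.exp (L x) := by
  have := nontrivial_of_mem_spectrum hspec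
  choose l hl using exists_isDyadicLog hU hspec
  have h0 := isDyadicLog_zero hspec
  have hmem (x : A) : l x ∈ spectrum ℂ x := by
    simpa using (hl x).add_add_mem_spectrum hU hspec h0 h0
  have hadd (x y : A) : l (x + y) = l x + l y := by
    have := (hl x).add_add_mem_spectrum hU hspec (hl y) ((hl (x + y)).neg hU hspec)
    rw [add_neg_cancel, spectrum.zero_eq, Set.mem_singleton_iff] at this
    linear_combination -this
  have hcont : Continuous (AddMonoidHom.mk' l hadd) :=
    AddMonoidHomClass.continuous_of_bound _ ‖(1 : A)‖ fun x => by
      rw [mul_comm]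
      exact spectrum.norm_le_norm_mul_of_mem (hmem x)
  refine ⟨(AddMonoidHom.mk' l hadd).toRealLinearMap hcont, hmem, fun x => ?_⟩
  obtain ⟨n, hn⟩ := (hl x).exists
  have hpow (m : ℕ) : f (exp x) = f (exp ((2⁻¹ : ℂ) ^ m • x)) ^ 2 ^ m := by
    induction m with
    | zero => simp
    | succ m ih =>
      rw [ih, pow_succ' 2 m, pow_mul, ← map_mul_self_of_mem_spectrum hU hspec,
        exp_two_inv_pow_succ_mul_self]
  rw [hpow n, hn, ← Complex.exp_nat_mul, ← mul_assoc]
  push_cast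
  rw [← mul_pow]
  simp

end

theorem map_exp_of_jordan (ψ : A →L[ℂ] ℂ) (h1 : ψ 1 = 1)
    (hJ : ∀ x y : A, ψ ((2 : ℂ)⁻¹ • (x * y + y * x)) = ψ x * ψ y) (x : A) :
    ψ (exp x) = Complex.exp (ψ x) := by
  have hpow (n : ℕ) : ψ (x ^ n) = ψ x ^ n := by
    induction n with
    | zero => simpa using h1
    | succ n ih =>
      rw [pow_succ (ψ x), ← ih, ← hJ, ← pow_succ, ← pow_succ', ← two_smul ℂ, smul_smul]
      norm_num
  have hA := (exp_series_hasSum_exp' (𝕂 := ℂ) x).mapL ψ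
  have hC := exp_series_hasSum_exp' (𝕂 := ℂ) (ψ x)
  simp only [map_smul, hpow] at hA
  rw [Complex.exp_eq_exp_ℂ]
  exact hA.unique hC

omit [CompleteSpace A] in
theorem map_mul_mul_of_jordan (ψ : A →L[ℂ] ℂ)
    (hJ : ∀ x y : A, ψ ((2 : ℂ)⁻¹ • (x * y + y * x)) = ψ x * ψ y) (x y : A) :
    ψ (x * y * x) = ψ x ^ 2 * ψ y := by
  have h1 := hJ x (x * y + y * x)
  have h2 := hJ (x * x) y
  have h3 := hJ x y
  have h4 := hJ x x
  simp only [map_smul, map_add, smul_eq_mul, mul_add, add_mul, ← mul_assoc] at h1 h2 h3 h4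
  linear_combination h1 - h2 + 2 * ψ x * h3 - ψ y * h4

section Component

variable {f g : A → ℂ} (hf : ∀ x y : A, f (x * y * x) = f x ^ 2 * f y)
  (hg : ∀ x y : A, g (x * y * x) = g x ^ 2 * g y) (hf1 : f 1 = 1) (hg1 : g 1 = 1)
  (hfg : ∀ x, f (exp x) = g (exp x))

include hf hg hf1 hg1 hfg

theorem eventually_sq_mul_sq_eq (p : Aˣ) :
    ∀ᶠ m in 𝓝 (p : A), f m ^ 2 * g p ^ 2 = f p ^ 2 * g m ^ 2 := by
  have hlim : Tendsto (fun m : A => ↑p⁻¹ * (m * m) * ↑p⁻¹) (𝓝 (p : A)) (𝓝 1) := by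
    have : Continuous fun m : A => ↑p⁻¹ * (m * m) * ↑p⁻¹ := by fun_prop
    simpa using this.tendsto (p : A)
  have hev : ∀ᶠ w in 𝓝 (1 : A), f w = g w :=
    eventually_nhds_one_of_exp (Eventually.of_forall hfg)
  filter_upwards [hlim.eventually hev] with m hm
  have h1 := hf m 1
  have h2 := hg m 1
  rw [mul_one] at h1 h2
  rw [hf, hg, h1, h2, hf1, hg1] at hm
  have hfp := map_mul_map_inv_eq_one hf hf1 p
  have hgp := map_mul_map_inv_eq_one hg hg1 p
  have hfp' : (f p * f ↑p⁻¹) ^ 2 = 1 := by rw [hfp, one_pow]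
  have hgp' : (g p * g ↑p⁻¹) ^ 2 = 1 := by rw [hgp, one_pow]
  linear_combination f p ^ 2 * g p ^ 2 * hm - f m ^ 2 * g p ^ 2 * hfp' + f p ^ 2 * g m ^ 2 * hgp'

theorem eventually_mul_eq_mul (p : Aˣ) : ∀ᶠ y in 𝓝 (p : A), f y * g p = f p * g y := by
  have hexp : ∀ᶠ v in 𝓝 (0 : A), f (p * exp v) * g p = f p * g (p * exp v) := by
    have hlim : Tendsto (fun v : A => p * exp ((2⁻¹ : ℂ) • v)) (𝓝 0) (𝓝 (p : A)) := by
      have hcont : Continuous (exp : A → A) := by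
        let : NormedAlgebra ℚ A := NormedAlgebra.restrictScalars ℚ ℂ A
        exact exp_continuous
      have : Continuous fun v : A => p * exp ((2⁻¹ : ℂ) • v) := by fun_prop
      simpa using this.tendsto 0
    filter_upwards [hlim.eventually (eventually_sq_mul_sq_eq hf hg hf1 hg1 hfg p)] with v hv
    have hmid : (p : A) * exp v =
        (p * exp ((2⁻¹ : ℂ) • v)) * ↑p⁻¹ * (p * exp ((2⁻¹ : ℂ) • v)) := by
      rw [← exp_half_smul_mul_self v]
      simp [mul_assoc]
    rw [hmid, hf, hg]
    have hfp := map_mul_map_inv_eq_one hf hf1 p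
    have hgp := map_mul_map_inv_eq_one hg hg1 p
    set m := (p : A) * exp ((2⁻¹ : ℂ) • v)
    linear_combination f ↑p⁻¹ * g ↑p⁻¹ * hv - f m ^ 2 * f ↑p⁻¹ * g p * hgp
      + f p * g m ^ 2 * g ↑p⁻¹ * hfp
  have hlim : Tendsto (fun y : A => ↑p⁻¹ * y) (𝓝 (p : A)) (𝓝 1) := by
    have : Continuous fun y : A => ↑p⁻¹ * y := by fun_prop
    simpa using this.tendsto (p : A)
  filter_upwards [hlim.eventually (eventually_nhds_one_of_exp
    (P := fun w => f (p * w) * g p = f p * g (p * w)) hexp)] with y hy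
  simpa using hy

theorem eqOn_connectedComponentIn_isUnit :
    ∀ x ∈ connectedComponentIn {x : A | IsUnit x} 1, f x = g x := by
  have hopen (s : Set ℂ) : IsOpen {x : A | IsUnit x ∧ f x / g x ∈ s} := by
    rw [isOpen_iff_eventually]
    rintro _ ⟨⟨p, rfl⟩, hp⟩
    filter_upwards [eventually_mul_eq_mul hf hg hf1 hg1 hfg p, Units.nhds p] with y hy hu
    have hgp := left_ne_zero_of_mul_eq_one (map_mul_map_inv_eq_one hg hg1 p)
    have hgy : g y ≠ 0 := by
      obtain ⟨q, rfl⟩ := hu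
      exact left_ne_zero_of_mul_eq_one (map_mul_map_inv_eq_one hg hg1 q)
    refine ⟨hu, ?_⟩
    rwa [(div_eq_div_iff hgy hgp).mpr hy]
  have h1 : (1 : A) ∈ connectedComponentIn {x : A | IsUnit x} 1 :=
    mem_connectedComponentIn isUnit_one
  have hunit : ∀ x ∈ connectedComponentIn {x : A | IsUnit x} 1, IsUnit x :=
    connectedComponentIn_subset {x : A | IsUnit x} 1
  have hsub : connectedComponentIn {x : A | IsUnit x} 1 ⊆
      {x : A | IsUnit x ∧ f x / g x ∈ ({1} : Set ℂ)} := IsPreconnected.subset_left_of_subset_union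
    (hopen {1}) (hopen {1}ᶜ)
    (Set.disjoint_left.mpr fun x hx hx' => hx'.2 hx.2)
    (fun x hx => (em (f x / g x ∈ ({1} : Set ℂ))).imp (⟨hunit x hx, ·⟩) (⟨hunit x hx, ·⟩))
    ⟨1, h1, isUnit_one, by simp [hf1, hg1]⟩ isPreconnected_connectedComponentIn
  exact fun x hx => eq_of_div_eq_one (hsub hx).2

end Component

theorem eq_of_eqOn_connectedComponentIn_isUnit {φ ψ : A →L[ℂ] ℂ}
    (h : ∀ x ∈ connectedComponentIn {x : A | IsUnit x} 1, φ x = ψ x) : φ = ψ := by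
  have hnhds : connectedComponentIn {x : A | IsUnit x} 1 ∈ 𝓝 (1 : A) :=
    connectedComponentIn_mem_nhds (Units.isOpen.mem_nhds isUnit_one)
  ext x
  have hlim : Tendsto (fun t : ℂ => 1 + t • x) (𝓝[≠] 0) (𝓝 1) := by
    have : Continuous fun t : ℂ => 1 + t • x := by fun_prop
    simpa using (this.tendsto 0).mono_left nhdsWithin_le_nhds
  obtain ⟨t, ht, ht0⟩ := ((hlim.eventually hnhds).and self_mem_nhdsWithin).exists
  have h1 := h 1 (mem_of_mem_nhds hnhds)
  have h2 := h _ ht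
  simp only [map_add, map_smul, smul_eq_mul, h1] at h2
  exact mul_left_cancel₀ ht0 (add_left_cancel h2)

end Spectral

/-- Associative instance of Theorem 3.10: a spectral-valued functional `f`
with `f (x y x) = f x ^ 2 * f y` agrees with a unique continuous
Jordan-multiplicative linear functional on the principal component of the
invertible elements. -/
theorem spectral_U_preserving_functional
    {A : Type*} [NormedRing A] [NormedAlgebra ℂ A] [CompleteSpace A]
    (f : A → ℂ)
    (hU : ∀ x y : A, f (x * y * x) = f x ^ 2 * f y)
    (hspec : ∀ x : A, f x ∈ spectrum ℂ x) :
    ∃! ψ : A →L[ℂ] ℂ,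
      (∀ x y : A, ψ ((2 : ℂ)⁻¹ • (x * y + y * x)) = ψ x * ψ y) ∧
      ∀ x ∈ connectedComponentIn {x : A | IsUnit x} 1, f x = ψ x := by
  have := nontrivial_of_mem_spectrum hspec
  obtain ⟨L, hL, hexp⟩ := exists_realLinear_log hU hspec
  let ψ : A →L[ℂ] ℂ := L.complexOfMapI (map_I_smul_of_mem_spectrum L hL)
  have h1 : ψ 1 = 1 := by
    change L 1 = 1
    simpa using hL 1
  have hne (u : A) (hu : IsUnit u) : ψ u ≠ 0 := fun h0 =>
    spectrum.zero_notMem ℂ hu (h0 ▸ hL u)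
  have hsq (x : A) : ψ (x ^ 2) = ψ x ^ 2 := map_sq_of_ne_zero_on_isUnit ψ.toLinearMap h1 hne x
  have hJ (x y : A) : ψ ((2 : ℂ)⁻¹ • (x * y + y * x)) = ψ x * ψ y := by
    have h := hsq (x + y)
    have hx := hsq x
    have hy := hsq y
    simp only [sq, add_mul, mul_add, map_add] at h hx hy
    rw [map_smul, map_add, smul_eq_mul]
    linear_combination h / 2 - hx / 2 - hy / 2
  have hψ : ∀ x ∈ connectedComponentIn {x : A | IsUnit x} 1, f x = ψ x :=
    eqOn_connectedComponentIn_isUnit hU (map_mul_mul_of_jordan ψ hJ)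
      (map_one_of_mem_spectrum hspec) h1
      fun x => (hexp x).trans (map_exp_of_jordan ψ h1 hJ x).symm
  exact ⟨ψ, ⟨hJ, hψ⟩, fun φ hφ => eq_of_eqOn_connectedComponentIn_isUnit fun x hx =>
    (hφ.2 x hx).symm.trans (hψ x hx)⟩
end

section
/- Let A be a unital complex Banach algebra and let f : A → ℂ be a (not necessarily linear) functional satisfying f(x·y·x) = f(x)²·f(y) for all x, y ∈ A and f(x) ∈ σ(x) for all x ∈ A. Then f is 1-homogeneous: f(λ·x) = λ·f(x) for all λ ∈ ℂ and all x ∈ A. -/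
/-- Associative instance of Remark 3.11: a spectral-valued functional `f` with
`f (x y x) = f x ^ 2 * f y` is `1`-homogeneous. -/
theorem spectral_U_preserving_functional_homogeneous
    {A : Type*} [NormedRing A] [NormedAlgebra ℂ A] [CompleteSpace A]
    (f : A → ℂ)
    (hU : ∀ x y : A, f (x * y * x) = f x ^ 2 * f y)
    (hspec : ∀ x : A, f x ∈ spectrum ℂ x) :
    ∀ (l : ℂ) (x : A), f (l • x) = l * f x := by
  intro l x
  have : Nontrivial A := by
    by_contra h
    have := not_nontrivial_iff_subsingleton.mp h
    simpa [spectrum.of_subsingleton] using hspec 0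
  have h_scalar (c : ℂ) : f (algebraMap ℂ A c) = c := by
    simpa [spectrum.scalar_eq] using hspec (algebraMap ℂ A c)
  obtain ⟨m, rfl⟩ := IsAlgClosed.exists_pow_nat_eq l (n := 2) two_pos
  have h := hU (algebraMap ℂ A m) x
  rwa [h_scalar, ← Algebra.commutes, ← mul_assoc, ← map_mul, ← sq, ← Algebra.smul_def] at h
end

section
/- Let A be a unital complex Banach algebra and let f : A → ℂ be a functional satisfying: (a) f is continuous; (b) f(x·y·x) = f(x)²·f(y) for all x, y ∈ A; (c) f(x) ∈ σ(x) for all x ∈ A. Let ψ : A → ℂ be a continuous ℂ-linear functional with ψ((xy+yx)/2) = ψ(x)·ψ(y) for all x, y ∈ A that agrees with f on the connected component of 1 in the set of invertible elements of A. If x ∈ A is such that σ(x) is contained in a line of the complex plane (i.e. there exist z, w ∈ ℂ with σ(x) ⊆ {z + t·w : t ∈ ℝ}), then f(λ·1 − x) = λ − ψ(x) for all λ ∈ ℂ; in particular f(x) = ψ(x). -/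
section LineSpectrum

variable {A : Type*} [NormedRing A] [NormedAlgebra ℂ A]

/-- Nonzero scalars lie in the connected component of `1` in the invertible elements. -/
theorem smul_one_mem_connectedComponentIn_isUnit {v : ℂ} (hv : v ≠ 0) :
    v • (1 : A) ∈ connectedComponentIn {x : A | IsUnit x} 1 := by
  have hpre : IsPreconnected ((fun c : ℂ ↦ c • (1 : A)) '' {0}ᶜ) :=
    (isConnected_compl_singleton_of_one_lt_rank (by simp) 0).isPreconnected.image _ (by fun_prop)
  refine hpre.subset_connectedComponentIn ⟨1, by simp⟩ ?_ ⟨v, hv, rfl⟩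
  rintro _ ⟨c, hc, rfl⟩
  have hc0 : c ≠ 0 := hc
  exact isUnit_one.smul (Units.mk0 c hc0)

/-- If the spectrum of `x` lies in a line and `l` lies off that line, then `l • 1 - x` belongs to
the connected component of `1` in the invertible elements. -/
theorem smul_one_sub_mem_connectedComponentIn_isUnit {x : A} {z w l : ℂ}
    (hline : spectrum ℂ x ⊆ {c : ℂ | ∃ t : ℝ, c = z + (t : ℂ) * w})
    (hl : ¬ ∃ t : ℝ, l = z + (t : ℂ) * w) :
    l • (1 : A) - x ∈ connectedComponentIn {x : A | IsUnit x} 1 := by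
  have hlz : l - z ≠ 0 := fun h ↦ hl ⟨0, by simpa using sub_eq_zero.mp h⟩
  have hunit : segment ℝ (l • (1 : A) - x) ((l - z) • (1 : A)) ⊆ {x : A | IsUnit x} := by
    rintro _ ⟨a, b, ha, hb, hab, rfl⟩
    rcases ha.eq_or_lt with rfl | ha
    · obtain rfl : b = 1 := by linarith
      have hu : IsUnit ((l - z) • (1 : A)) := isUnit_one.smul (Units.mk0 _ hlz)
      simpa using hu
    · have ha' : (a : ℂ) ≠ 0 := by exact_mod_cast ha.ne'
      have hab' : (a : ℂ) + b = 1 := by exact_mod_cast hab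
      have hmem : l + (b / a : ℂ) * (l - z) ∉ spectrum ℂ x := by
        intro h
        obtain ⟨t, ht⟩ := hline h
        refine hl ⟨a * t, ?_⟩
        field_simp at ht
        push_cast
        linear_combination ht - (l - z) * hab'
      have hu := (spectrum.notMem_iff.mp hmem).smul (Units.mk0 _ ha')
      rw [Algebra.algebraMap_eq_smul_one, Units.smul_mk0, smul_sub, smul_smul] at hu
      have key : a • (l • (1 : A) - x) + b • ((l - z) • (1 : A)) =
          ((a : ℂ) * (l + (b / a : ℂ) * (l - z))) • (1 : A) - (a : ℂ) • x := by
        rw [← Complex.coe_smul a, ← Complex.coe_smul b, mul_add, ← mul_assoc, mul_div_cancel₀ _ ha']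
        module
      rw [Set.mem_ofPred_eq, key]
      exact hu
  have hsub := (convex_segment (𝕜 := ℝ) (l • (1 : A) - x)
    ((l - z) • (1 : A))).isPreconnected.subset_connectedComponentIn
    (right_mem_segment ℝ _ _) hunit
  rw [connectedComponentIn_eq (smul_one_mem_connectedComponentIn_isUnit (A := A) hlz)]
  exact hsub (left_mem_segment ℝ _ _)

/-- A continuous function agreeing with a unital continuous linear functional on the connected
component of `1` in the invertible elements also agrees with it on all `l • 1 - x`, provided the
spectrum of `x` lies in a line. -/
theorem apply_smul_one_sub_of_spectrum_subset_line {f : A → ℂ} (hcont : Continuous f)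
    {ψ : A →L[ℂ] ℂ} (hone : ψ 1 = 1)
    (hagree : ∀ x ∈ connectedComponentIn {x : A | IsUnit x} 1, f x = ψ x) {x : A} {z w : ℂ}
    (hw : w ≠ 0) (hline : spectrum ℂ x ⊆ {c : ℂ | ∃ t : ℝ, c = z + (t : ℂ) * w}) (l : ℂ) :
    f (l • (1 : A) - x) = l - ψ x := by
  have hoff (l : ℂ) (hl : ¬ ∃ t : ℝ, l = z + (t : ℂ) * w) :
      f (l • (1 : A) - x) = l - ψ x := by
    rw [hagree _ (smul_one_sub_mem_connectedComponentIn_isUnit hline hl)]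
    simp [hone]
  by_cases hl : ∃ t : ℝ, l = z + (t : ℂ) * w
  · obtain ⟨t, rfl⟩ := hl
    have hext : (fun s : ℝ ↦ f ((z + t * w + s * (Complex.I * w)) • (1 : A) - x)) =
        fun s : ℝ ↦ z + t * w + s * (Complex.I * w) - ψ x := by
      refine Continuous.ext_on (dense_compl_singleton (0 : ℝ)) (by fun_prop) (by fun_prop) ?_
      intro s hs
      refine hoff _ ?_
      rintro ⟨r, hr⟩
      have h : (t : ℂ) + s * Complex.I = r := by
        apply mul_right_cancel₀ hw
        linear_combination hr
      exact hs (by simpa using congrArg Complex.im h)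
    simpa using congrFun hext 0
  · exact hoff l hl

end LineSpectrum


/-- Second part of Lemma 4.1 in the associative setting: if the spectrum of
`x` is contained in a line, then `f (λ1 - x) = λ - ψ x` for every `λ`, and in
particular `f x = ψ x`. -/
theorem spectral_U_functional_spectrum_in_line
    {A : Type*} [NormedRing A] [NormedAlgebra ℂ A] [CompleteSpace A]
    (f : A → ℂ)
    (hcont : Continuous f)
    (hU : ∀ x y : A, f (x * y * x) = f x ^ 2 * f y)
    (hspec : ∀ x : A, f x ∈ spectrum ℂ x)
    (ψ : A →L[ℂ] ℂ)
    (hψmul : ∀ x y : A, ψ ((2 : ℂ)⁻¹ • (x * y + y * x)) = ψ x * ψ y)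
    (hagree : ∀ x ∈ connectedComponentIn {x : A | IsUnit x} 1, f x = ψ x)
    (x : A) (z w : ℂ)
    (hline : spectrum ℂ x ⊆ {c : ℂ | ∃ t : ℝ, c = z + (t : ℂ) * w}) :
    (∀ l : ℂ, f (l • (1 : A) - x) = l - ψ x) ∧ f x = ψ x := by
  have : Nontrivial A := by
    by_contra h
    rw [not_nontrivial_iff_subsingleton] at h
    simpa using hspec 0
  have hone : ψ 1 = 1 := by
    rw [← hagree 1 (mem_connectedComponentIn isUnit_one)]
    simpa using hspec 1
  obtain ⟨w, hw, hline⟩ : ∃ w' : ℂ, w' ≠ 0 ∧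
      spectrum ℂ x ⊆ {c : ℂ | ∃ t : ℝ, c = z + (t : ℂ) * w'} := by
    by_cases hw : w = 0
    · refine ⟨1, one_ne_zero, fun c hc ↦ ⟨0, ?_⟩⟩
      obtain ⟨t, ht⟩ := hline hc
      simpa [hw] using ht
    · exact ⟨w, hw, hline⟩
  have hneg : spectrum ℂ (-x) ⊆ {c : ℂ | ∃ t : ℝ, c = -z + (t : ℂ) * w} := by
    rw [← spectrum.neg_eq]
    intro c hc
    obtain ⟨t, ht⟩ := hline hc
    exact ⟨-t, by push_cast; linear_combination -ht⟩
  refine ⟨apply_smul_one_sub_of_spectrum_subset_line hcont hone hagree hw hline, ?_⟩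
  simpa using apply_smul_one_sub_of_spectrum_subset_line hcont hone hagree hw hneg 0
end

section
/- Let A be a unital C*-algebra and let f : A → ℂ be a (not necessarily linear) functional satisfying: (a) f is continuous; (b) f(x·y·x) = f(x)²·f(y) for all x, y ∈ A; (c) f(x) ∈ σ(x) for all x ∈ A. Then f is ℂ-linear (f(x+y) = f(x)+f(y) and f(λx) = λf(x) for all x, y ∈ A, λ ∈ ℂ) and Jordan-multiplicative: f((xy+yx)/2) = f(x)·f(y) for all x, y ∈ A. -/
/-- A continuous functional on a unital C⋆-algebra which takes values in the spectrum and is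
compatible with the quadratic operators `y ↦ x * y * x`. -/
structure IsSpectralUFunctional {A : Type*} [CStarAlgebra A] (f : A → ℂ) : Prop where
  continuous : Continuous f
  map_mul_mul : ∀ x y : A, f (x * y * x) = f x ^ 2 * f y
  mem_spectrum : ∀ x : A, f x ∈ spectrum ℂ x

open Filter Topology NormedSpace in
/-- A symmetrized Lie–Trotter product formula. -/
theorem tendsto_exp_mul_exp_mul_exp_pow {A : Type*} [NormedRing A] [NormedAlgebra ℝ A]
    [CompleteSpace A] (x y : A) :
    Tendsto (fun n : ℕ ↦ (exp ((n : ℝ)⁻¹ • x) * exp ((n : ℝ)⁻¹ • y) * exp ((n : ℝ)⁻¹ • x)) ^ n)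
      atTop (𝓝 (exp (x + y + x))) := by
  let _ : NormedAlgebra ℚ A := NormedAlgebra.restrictScalars ℚ ℝ A
  have hE : HasStrictFDerivAt (exp : A → A)
      ((ContinuousLinearEquiv.refl ℝ A : A ≃L[ℝ] A) : A →L[ℝ] A) 0 :=
    hasStrictFDerivAt_exp_zero
  set L : A → A := hE.localInverse exp _ 0 with hL
  have hL1 : L 1 = 0 := by simpa using hE.localInverse_apply_image
  have hLd : HasFDerivAt L (ContinuousLinearMap.id ℝ A) 1 := by
    simpa using hE.to_localInverse.hasFDerivAt
  have hLexp : ∀ᶠ z in 𝓝 (1 : A), exp (L z) = z := by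
    simpa using hE.eventually_right_inverse
  set γ : ℝ → A := fun t ↦ exp (t • x) * exp (t • y) * exp (t • x) with hγ
  have hγ0 : γ 0 = 1 := by simp [hγ]
  have hexp : ∀ z : A, HasDerivAt (fun t : ℝ ↦ exp (t • z)) z 0 := fun z ↦ by
    simpa using hasDerivAt_exp_smul_const (𝕂 := ℝ) z (0 : ℝ)
  have hγd : HasDerivAt γ (x + y + x) 0 := by
    have := ((hexp x).mul (hexp y)).mul (hexp x)
    simp only [Pi.mul_apply, zero_smul, exp_zero, one_mul, mul_one] at this
    exact this
  have hLγ : HasDerivAt (L ∘ γ) (x + y + x) 0 := by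
    have h1 : HasFDerivAt L (ContinuousLinearMap.id ℝ A) (γ 0) := by rwa [hγ0]
    simpa using h1.comp_hasDerivAt (0 : ℝ) hγd
  have hinv : Tendsto (fun n : ℕ ↦ (n : ℝ)⁻¹) atTop (𝓝[≠] 0) :=
    tendsto_nhdsWithin_iff.2 ⟨tendsto_inv_atTop_nhds_zero_nat, by
      filter_upwards [eventually_gt_atTop 0] with n hn
      simpa using hn.ne'⟩
  have hlim : Tendsto (fun n : ℕ ↦ (n : ℝ) • L (γ (n : ℝ)⁻¹)) atTop (𝓝 (x + y + x)) := by
    have := hLγ.tendsto_slope_zero.comp hinv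
    simpa [Function.comp_def, hγ0, hL1] using this
  have hγt : Tendsto (fun n : ℕ ↦ γ (n : ℝ)⁻¹) atTop (𝓝 1) := by
    have := hγd.continuousAt.tendsto.comp (tendsto_inv_atTop_nhds_zero_nat (𝕜 := ℝ))
    rwa [hγ0] at this
  refine hlim.exp.congr' ?_
  filter_upwards [hγt.eventually hLexp] with n hn
  rw [Nat.cast_smul_eq_nsmul, exp_nsmul, hn]

/-- Two real bump functions at the origin, the second one being `1` on the support of the first
and vanishing away from the origin. -/
theorem exists_bump_functions {δ : ℝ} (hδ : 0 < δ) :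
    ∃ φ χ : ℝ → ℝ, Continuous φ ∧ Continuous χ ∧ (∀ s, φ s * χ s = φ s) ∧ (∀ s, 0 ≤ φ s) ∧
      φ 0 = 1 ∧ (∀ s, 0 ≤ χ s) ∧ (∀ s, χ s ≤ 1) ∧ ∀ s, δ < |s| → χ s = 0 := by
  refine ⟨fun s ↦ max 0 (1 - 2 * |s| / δ), fun s ↦ min 1 (max 0 (2 - 2 * |s| / δ)), by fun_prop,
    by fun_prop, fun s ↦ ?_, fun s ↦ le_max_left _ _, by simp,
    fun s ↦ le_min zero_le_one (le_max_left _ _), fun s ↦ min_le_left _ _, fun s hs ↦ ?_⟩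
  · rcases le_total (1 - 2 * |s| / δ) 0 with h | h
    · simp only [max_eq_left h, zero_mul]
    · beta_reduce
      rw [min_eq_left (le_max_of_le_right (by linarith)), mul_one]
  · have : 2 ≤ 2 * |s| / δ := by
      rw [le_div_iff₀ hδ]
      linarith
    simp only [max_eq_left (sub_nonpos.2 this), min_eq_right (zero_le_one' ℝ)]

namespace IsSpectralUFunctional

open Filter Topology NormedSpace

variable {A : Type*} [CStarAlgebra A] {f : A → ℂ}

theorem nontrivial (hf : IsSpectralUFunctional f) : Nontrivial A := by
  by_contra h
  rw [not_nontrivial_iff_subsingleton] at h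
  simpa [spectrum.of_subsingleton] using hf.mem_spectrum 0

theorem norm_apply_le (hf : IsSpectralUFunctional f) (x : A) : ‖f x‖ ≤ ‖x‖ :=
  have := hf.nontrivial
  spectrum.norm_le_norm_of_mem (hf.mem_spectrum x)

theorem map_algebraMap (hf : IsSpectralUFunctional f) (c : ℂ) : f (algebraMap ℂ A c) = c := by
  have := hf.nontrivial
  simpa using hf.mem_spectrum (algebraMap ℂ A c)

theorem map_one (hf : IsSpectralUFunctional f) : f 1 = 1 := by
  simpa using hf.map_algebraMap 1

theorem map_exp_ne_zero (hf : IsSpectralUFunctional f) (x : A) : f (exp x) ≠ 0 := fun h ↦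
  let _ : NormedAlgebra ℚ A := NormedAlgebra.restrictScalars ℚ ℝ A
  spectrum.zero_notMem ℂ (isUnit_exp x) (h ▸ hf.mem_spectrum (exp x))

theorem map_pow (hf : IsSpectralUFunctional f) (x : A) (n : ℕ) : f (x ^ n) = f x ^ n := by
  induction n using Nat.twoStepInduction with
  | zero => simpa using hf.map_one
  | one => simp
  | more n ih _ =>
    rw [show x ^ (n + 2) = x * x ^ n * x by rw [← pow_succ', ← pow_succ], hf.map_mul_mul, ih]
    ring

theorem map_exp_add (hf : IsSpectralUFunctional f) (x y : A) :
    f (exp (x + y)) = f (exp x) * f (exp y) := by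
  let _ : NormedAlgebra ℚ A := NormedAlgebra.restrictScalars ℚ ℝ A
  set u : A := (2 : ℝ)⁻¹ • x with hu
  have hx : x = u + u := by rw [hu, ← two_smul ℝ, smul_smul]; norm_num
  have hsq : ∀ z : A, f (exp z) ^ 2 = f (exp (z + z)) := fun z ↦ by
    rw [← hf.map_pow, sq, ← exp_add_of_commute (Commute.refl z)]
  have hlim := (hf.continuous.tendsto _).comp (tendsto_exp_mul_exp_mul_exp_pow u y)
  have hconst : ∀ᶠ n : ℕ in atTop, f ((exp ((n : ℝ)⁻¹ • u) * exp ((n : ℝ)⁻¹ • y) *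
      exp ((n : ℝ)⁻¹ • u)) ^ n) = f (exp x) * f (exp y) := by
    filter_upwards [eventually_gt_atTop 0] with n hn
    have hn' : (n : ℝ) ≠ 0 := by positivity
    rw [hf.map_pow, hf.map_mul_mul, hsq, mul_pow, ← hf.map_pow, ← hf.map_pow, ← exp_nsmul,
      ← exp_nsmul, ← smul_add, ← hx, ← Nat.cast_smul_eq_nsmul ℝ, ← Nat.cast_smul_eq_nsmul ℝ,
      smul_inv_smul₀ hn', smul_inv_smul₀ hn']
  have := tendsto_nhds_unique hlim (tendsto_const_nhds.congr' (hconst.mono fun _ h ↦ h.symm))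
  rw [← this, hx]
  congr 2
  abel

theorem exists_map_exp_cfc_eq (hf : IsSpectralUFunctional f) {h : A} (hh : IsSelfAdjoint h)
    {u v : ℝ → ℝ} (hu : Continuous u) (hv : Continuous v) :
    ∃ s : ℝ, |s| ≤ ‖h‖ ∧
      f (exp (cfc u h + Complex.I • cfc v h)) = Complex.exp (u s + Complex.I * v s) := by
  have := hf.nontrivial
  have hn : IsStarNormal h := hh.isStarNormal
  set P : ℂ → ℂ := fun z ↦ (u z.re : ℂ) + Complex.I * (v z.re : ℂ) with hP
  have hPc : Continuous P := by fun_prop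
  have hcfc : cfc u h + Complex.I • cfc v h = cfc P h := by
    rw [hP, cfc_add _ _ _, cfc_const_mul _ _ _, cfc_real_eq_complex u, cfc_real_eq_complex v]
  have hmem := hf.mem_spectrum (exp (cfc u h + Complex.I • cfc v h))
  rw [hcfc, ← CFC.complex_exp_eq_normedSpace_exp (cfc_predicate P h),
    ← cfc_comp' Complex.exp P h, cfc_map_spectrum ..] at hmem
  obtain ⟨z, hz, hzf⟩ := hmem
  refine ⟨z.re, (Complex.abs_re_le_norm z).trans (spectrum.norm_le_norm_of_mem hz), ?_⟩
  rw [hcfc, ← CFC.complex_exp_eq_normedSpace_exp (cfc_predicate P h),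
    ← cfc_comp' Complex.exp P h, ← hzf]

/-- On exponentials, `f` is the exponential of a linear functional which is real on selfadjoint
elements. -/
theorem exists_linearMap (hf : IsSpectralUFunctional f) :
    ∃ g : A →ₗ[ℂ] ℂ, (∀ x, f (exp x) = Complex.exp (g x)) ∧
      ∀ h, IsSelfAdjoint h → (g h).im = 0 := by
  let _ : NormedAlgebra ℚ A := NormedAlgebra.restrictScalars ℚ ℝ A
  have hcont : Continuous fun x : A ↦ Real.log ‖f (exp x)‖ :=
    (hf.continuous.comp exp_continuous).norm.log fun x ↦ norm_ne_zero_iff.2 (hf.map_exp_ne_zero x)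
  let ρ₀ : A →+ ℝ := AddMonoidHom.mk' (fun x ↦ Real.log ‖f (exp x)‖) fun x y ↦ by
    rw [hf.map_exp_add, norm_mul, Real.log_mul] <;> simpa using hf.map_exp_ne_zero _
  let ρ : A →L[ℝ] ℝ := ρ₀.toRealLinearMap hcont
  have hρ : ∀ x, ρ x = Real.log ‖f (exp x)‖ := fun x ↦ rfl
  have key : ∀ h : A, IsSelfAdjoint h → ρ (Complex.I • h) = 0 ∧
      f (exp h) = Complex.exp (ρ h) ∧
      f (exp (Complex.I • h)) = Complex.exp (Complex.I * ρ h) := by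
    intro h hh
    obtain ⟨s, -, hs⟩ := hf.exists_map_exp_cfc_eq hh continuous_zero continuous_id
    obtain ⟨r, -, hr⟩ := hf.exists_map_exp_cfc_eq hh continuous_id continuous_zero
    obtain ⟨q, -, hq⟩ := hf.exists_map_exp_cfc_eq hh continuous_id continuous_id
    simp only [cfc_id ℝ h] at hs hr hq
    have hz : cfc (0 : ℝ → ℝ) h = 0 := cfc_const_zero ℝ h
    simp only [hz, id, Pi.zero_apply, Complex.ofReal_zero, smul_zero, add_zero, zero_add,
      mul_zero] at hs hr hq
    have h1 : ρ (Complex.I • h) = 0 := by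
      rw [hρ, hs]; simp [Complex.norm_exp]
    have h2 : ρ h = r := by rw [hρ, hr]; simp [Complex.norm_exp]
    have h3 : ρ (h + Complex.I • h) = q := by rw [hρ, hq]; simp [Complex.norm_exp]
    have h4 : q = r := by rw [← h3, map_add, h1, h2, add_zero]
    refine ⟨h1, by rw [hr, h2], ?_⟩
    rw [hf.map_exp_add, hr, Complex.exp_add, h4] at hq
    rw [h2]
    exact mul_left_cancel₀ (Complex.exp_ne_zero _) hq
  refine ⟨(StrongDual.extendRCLike (𝕜 := ℂ) ρ).toLinearMap, fun x ↦ ?_, fun h hh ↦ ?_⟩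
  · have hre := key (realPart x : A) (realPart x).2
    have him := key (imaginaryPart x : A) (imaginaryPart x).2
    have hx := realPart_add_I_smul_imaginaryPart x
    rw [← hx, hf.map_exp_add, hre.2.1, him.2.2, ← Complex.exp_add]
    congr 1
    simp [StrongDual.extendRCLike_apply, smul_add, smul_smul, hre.1, him.1]
  · have := (key h hh).1
    simp [StrongDual.extendRCLike_apply, this]

theorem linearMap_cfc (hf : IsSpectralUFunctional f) {g : A →ₗ[ℂ] ℂ}
    (hg : ∀ x, f (exp x) = Complex.exp (g x)) (hg_im : ∀ h, IsSelfAdjoint h → (g h).im = 0)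
    {h : A} (hh : IsSelfAdjoint h) {φ : ℝ → ℝ} (hφ : Continuous φ) :
    g (cfc φ h) = φ (g h).re := by
  set r : ℝ := (g h).re with hr
  have hgh : g h = r := Complex.ext rfl (by simp [hg_im h hh])
  have hgφ : g (cfc φ h) = (g (cfc φ h)).re :=
    Complex.ext rfl (by simp [hg_im _ (cfc_predicate φ h)])
  set t : ℝ := (1 + ‖h‖ + |r|)⁻¹ with ht
  have hden : 0 < 1 + ‖h‖ + |r| := by positivity
  have ht0 : 0 < t := inv_pos.2 hden
  have hbound : ∀ s : ℝ, |s| ≤ ‖h‖ + |r| → -Real.pi < t * s ∧ t * s ≤ Real.pi := fun s hs ↦ by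
    have h1 : |t * s| ≤ 1 := by
      rw [abs_mul, abs_of_pos ht0, ht, inv_mul_le_one₀ hden]
      linarith
    have := abs_le.1 h1
    have := Real.pi_gt_three
    constructor <;> linarith
  obtain ⟨s, hs, hfs⟩ := hf.exists_map_exp_cfc_eq hh hφ (continuous_const_mul t)
  rw [cfc_const_mul_id t h, hg, map_add, map_smul, ← Complex.coe_smul, map_smul, hgh, hgφ] at hfs
  have hs' := hbound s (hs.trans (by simp))
  have hr' := hbound r (by simp)
  have := Complex.exp_inj_of_neg_pi_lt_of_le_pi (by simpa using hr'.1) (by simpa using hr'.2)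
    (by simpa using hs'.1) (by simpa using hs'.2) hfs
  have hre := congrArg Complex.re this
  have him := congrArg Complex.im this
  simp at hre him
  rw [hgφ, hre, him.resolve_right ht0.ne']

theorem map_cfc_of_nonneg (hf : IsSpectralUFunctional f) {g : A →ₗ[ℂ] ℂ}
    (hg : ∀ x, f (exp x) = Complex.exp (g x)) (hg_im : ∀ h, IsSelfAdjoint h → (g h).im = 0)
    {h : A} (hh : IsSelfAdjoint h) {φ : ℝ → ℝ} (hφ : Continuous φ) (hφ0 : ∀ s, 0 ≤ φ s) :
    f (cfc φ h) = φ (g h).re := by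
  have hpos : ∀ t : ℝ, 0 < t → f (cfc φ h + algebraMap ℝ A t) = φ (g h).re + t := by
    intro t ht
    have hne : ∀ s, φ s + t ≠ 0 := fun s ↦ by linarith [hφ0 s]
    have hlog : Continuous fun s ↦ Real.log (φ s + t) := (hφ.add_const t).log hne
    have hexp : cfc φ h + algebraMap ℝ A t = exp (cfc (fun s ↦ Real.log (φ s + t)) h) := by
      rw [← CFC.real_exp_eq_normedSpace_exp (cfc_predicate _ h),
        ← cfc_comp' Real.exp (fun s ↦ Real.log (φ s + t)) h Real.continuous_exp.continuousOn
          hlog.continuousOn]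
      simp only [Real.exp_log (add_pos_of_nonneg_of_pos (hφ0 _) ht)]
      rw [cfc_add_const t φ h]
    rw [hexp, hg, hf.linearMap_cfc hg hg_im hh hlog, ← Complex.ofReal_exp,
      Real.exp_log (add_pos_of_nonneg_of_pos (hφ0 _) ht), Complex.ofReal_add]
  have hc : Continuous fun t : ℝ ↦ f (cfc φ h + algebraMap ℝ A t) :=
    hf.continuous.comp (continuous_const.add (continuous_algebraMap ℝ A))
  have hc' : Continuous fun t : ℝ ↦ ((φ (g h).re : ℂ) + t) := by fun_prop
  have h1 := (hc.tendsto 0).mono_left (nhdsWithin_le_nhds (s := Set.Ioi 0))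
  have h2 := (hc'.tendsto 0).mono_left (nhdsWithin_le_nhds (s := Set.Ioi 0))
  have := tendsto_nhds_unique_of_eventuallyEq h1 h2
    (by filter_upwards [self_mem_nhdsWithin] with t ht using hpos t ht)
  simpa using this

theorem linearMap_mul_add_mul (hf : IsSpectralUFunctional f) {g : A →ₗ[ℂ] ℂ}
    (hg : ∀ x, f (exp x) = Complex.exp (g x)) (hg_im : ∀ h, IsSelfAdjoint h → (g h).im = 0)
    (x y : A) : g (x * y + y * x) = 2 * (g x * g y) := by
  have hsa : ∀ h : A, IsSelfAdjoint h → g (h * h) = g h * g h := fun h hh ↦ by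
    have := hf.linearMap_cfc hg hg_im hh (continuous_pow 2)
    rw [cfc_pow_id h 2] at this
    rw [← sq, this, Complex.ofReal_pow, sq,
      show ((g h).re : ℂ) = g h from Complex.ext rfl (by simp [hg_im h hh])]
  have polar : ∀ a b : A, g ((a + b) * (a + b)) = g (a + b) * g (a + b) →
      g (a * a) = g a * g a → g (b * b) = g b * g b → g (a * b + b * a) = 2 * (g a * g b) := by
    intro a b hab ha hb
    rw [show (a + b) * (a + b) = a * a + (a * b + b * a) + b * b by noncomm_ring] at hab
    simp only [map_add, ha, hb] at hab ⊢
    linear_combination hab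
  have hsq : ∀ z : A, g (z * z) = g z * g z := fun z ↦ by
    have ha := (realPart z).2
    have hb := (imaginaryPart z).2
    rw [← realPart_add_I_smul_imaginaryPart z]
    set a : A := ((realPart z : selfAdjoint A) : A)
    set b : A := ((imaginaryPart z : selfAdjoint A) : A)
    have hab := polar a b (hsa _ (ha.add hb)) (hsa _ ha) (hsa _ hb)
    rw [show (a + Complex.I • b) * (a + Complex.I • b) =
        a * a - b * b + Complex.I • (a * b + b * a) by
      simp only [mul_add, add_mul, smul_mul_assoc, mul_smul_comm, smul_smul, Complex.I_mul_I,
        smul_add, neg_smul, one_smul]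
      abel]
    rw [map_add, map_sub, map_smul, hab, hsa _ ha, hsa _ hb, map_add, map_smul, smul_eq_mul,
      smul_eq_mul]
    linear_combination -(g b * g b) * Complex.I_sq
  exact polar x y (hsq _) (hsq _) (hsq _)

/-- Elements of the kernel of the Jordan functional are compressed to small elements by suitable
bumps `y` and `z`, with `z` a local unit for `y`. -/
theorem exists_bumps (hf : IsSpectralUFunctional f) {g : A →ₗ[ℂ] ℂ}
    (hg : ∀ x, f (exp x) = Complex.exp (g x)) (hg_im : ∀ h, IsSelfAdjoint h → (g h).im = 0)
    {j : A} (hj : g j = 0) {ε : ℝ} (hε : 0 < ε) :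
    ∃ y z : A, y * z = y ∧ z * y = y ∧ f y = 1 ∧ ‖z * j * z‖ ≤ ε := by
  let _ : PartialOrder A := CStarAlgebra.spectralOrder A
  have _ : StarOrderedRing A := CStarAlgebra.spectralOrderedRing A
  set a : A := star j * j + j * star j with ha
  have ha0 : 0 ≤ a := add_nonneg (star_mul_self_nonneg j) (mul_star_self_nonneg j)
  have hsa : IsSelfAdjoint a := .of_nonneg ha0
  have hga : g a = 0 := by rw [ha, hf.linearMap_mul_add_mul hg hg_im, hj]; simp
  obtain ⟨φ, χ, hφc, hχc, hφχ, hφ0, hφ1, hχ0, hχ1, hχδ⟩ := exists_bump_functions (sq_pos_of_pos hε)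
  have hz : IsSelfAdjoint (cfc χ a) := cfc_predicate χ a
  have hznorm : ‖cfc χ a‖ ≤ 1 := norm_cfc_le zero_le_one fun s _ ↦ by
    rw [Real.norm_of_nonneg (hχ0 s)]; exact hχ1 s
  have hzaz : ‖cfc χ a * a * cfc χ a‖ ≤ ε ^ 2 := by
    have : cfc χ a * a * cfc χ a = cfc (fun s ↦ χ s * s * χ s) a := by
      rw [cfc_mul (fun s ↦ χ s * s) χ a (hχc.mul continuous_id).continuousOn hχc.continuousOn,
        cfc_mul χ (fun s ↦ s) a hχc.continuousOn continuousOn_id, cfc_id' ℝ a]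
    rw [this]
    refine norm_cfc_le (by positivity) fun s _ ↦ ?_
    rw [norm_mul, norm_mul, Real.norm_of_nonneg (hχ0 s), Real.norm_eq_abs]
    rcases lt_or_ge (ε ^ 2) |s| with h | h
    · simp only [hχδ s h, zero_mul]
      positivity
    · calc χ s * |s| * χ s ≤ 1 * |s| * 1 := by
            gcongr <;> first | exact hχ1 s | exact hχ0 s
        _ ≤ ε ^ 2 := by simpa using h
  have hjz : ‖j * cfc χ a‖ ≤ ε := by
    refine (sq_le_sq₀ (norm_nonneg _) hε.le).1 ?_
    have h1 : star (j * cfc χ a) * (j * cfc χ a) = cfc χ a * (star j * j) * cfc χ a := by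
      rw [star_mul, hz.star_eq]; simp only [mul_assoc]
    rw [sq, ← CStarRing.norm_star_mul_self, h1]
    refine (CStarAlgebra.norm_le_norm_of_nonneg_of_le ?_ ?_).trans hzaz
    · rw [← h1]; exact star_mul_self_nonneg _
    · exact hz.conjugate_le_conjugate (le_add_of_nonneg_right (mul_star_self_nonneg j))
  refine ⟨cfc φ a, cfc χ a, ?_, ?_, ?_, ?_⟩
  · rw [← cfc_mul φ χ a hφc.continuousOn hχc.continuousOn]; simp only [hφχ]
  · rw [← cfc_mul χ φ a hχc.continuousOn hφc.continuousOn]; simp only [mul_comm (χ _), hφχ]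
  · rw [hf.map_cfc_of_nonneg hg hg_im hsa hφc hφ0, hga]
    simp [hφ1]
  · rw [mul_assoc]
    calc ‖cfc χ a * (j * cfc χ a)‖ ≤ ‖cfc χ a‖ * ‖j * cfc χ a‖ := norm_mul_le _ _
      _ ≤ 1 * ε := by gcongr
      _ = ε := one_mul ε

theorem eq_linearMap (hf : IsSpectralUFunctional f) {g : A →ₗ[ℂ] ℂ}
    (hg : ∀ x, f (exp x) = Complex.exp (g x)) (hg_im : ∀ h, IsSelfAdjoint h → (g h).im = 0)
    (x : A) : f x = g x := by
  set c : A := algebraMap ℂ A (g x) with hc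
  have hg1 : g 1 = 1 := by
    have := hf.linearMap_cfc hg hg_im (IsSelfAdjoint.one A) (continuous_const (y := (1 : ℝ)))
    simpa [cfc_const_one ℝ (1 : A)] using this
  have hj : g (x - c) = 0 := by
    rw [map_sub, hc, Algebra.algebraMap_eq_smul_one, map_smul, hg1]; simp
  have hlim : Tendsto (fun w ↦ f (c + w)) (𝓝 0) (𝓝 (g x)) := by
    have := (hf.continuous.comp (continuous_const_add c)).tendsto 0
    simpa only [hc, Function.comp_def, add_zero, hf.map_algebraMap] using this
  refine dist_le_zero.1 (le_of_forall_pos_le_add fun η hη ↦ ?_)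
  obtain ⟨ε, hε, hball⟩ := Metric.tendsto_nhds_nhds.1 hlim η hη
  obtain ⟨y, z, hyz, hzy, hy, hle⟩ := hf.exists_bumps hg hg_im hj (half_pos hε)
  have hcompress : y * x * y = y * (c + z * (x - c) * z) * y := by
    have : y * (z * (x - c) * z) * y = (y * z) * (x - c) * (z * y) := by
      simp only [mul_assoc]
    rw [mul_add, add_mul, this, hyz, hzy]
    noncomm_ring
  have hfx : f x = f (c + z * (x - c) * z) := by
    have := congrArg f hcompress
    simpa [hf.map_mul_mul, hy] using this
  rw [hfx, zero_add]
  exact (hball (by rw [dist_zero_right]; linarith)).le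

end IsSpectralUFunctional

/-- Theorem 4.3 of the paper for the JB*-algebra underlying a unital
C*-algebra: a continuous spectral-valued functional with
`f (x y x) = f x ^ 2 * f y` is ℂ-linear and Jordan-multiplicative. -/
theorem continuous_spectral_U_functional_linear_cstar
    {A : Type*} [NormedRing A] [StarRing A] [CStarRing A] [CompleteSpace A]
    [NormedAlgebra ℂ A] [StarModule ℂ A]
    (f : A → ℂ)
    (hcont : Continuous f)
    (hU : ∀ x y : A, f (x * y * x) = f x ^ 2 * f y)
    (hspec : ∀ x : A, f x ∈ spectrum ℂ x) :
    (∀ x y : A, f (x + y) = f x + f y) ∧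
    (∀ (l : ℂ) (x : A), f (l • x) = l * f x) ∧
    (∀ x y : A, f ((2 : ℂ)⁻¹ • (x * y + y * x)) = f x * f y) := by
  let _ : CStarAlgebra A := {}
  have hf : IsSpectralUFunctional f := ⟨hcont, hU, hspec⟩
  obtain ⟨g, hg, hg_im⟩ := hf.exists_linearMap
  have hfg := hf.eq_linearMap hg hg_im
  refine ⟨fun x y ↦ ?_, fun l x ↦ ?_, fun x y ↦ ?_⟩
  · simp only [hfg, map_add]
  · simp only [hfg, map_smul, smul_eq_mul]
  · rw [hfg, map_smul, hf.linearMap_mul_add_mul hg hg_im, hfg, hfg, smul_eq_mul,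
      inv_mul_cancel_left₀ two_ne_zero]
end

section
/- Let A be a unital C*-algebra and let f : A → ℂ be a (not necessarily linear) functional satisfying: (a) f is continuous; (b) f(xy) = f(x)·f(y) for all x, y ∈ A; (c) f(x) ∈ σ(x) for all x ∈ A. Then f is ℂ-linear (f(x+y) = f(x)+f(y) and f(λx) = λ·f(x) for all x, y ∈ A, λ ∈ ℂ), and hence f is a character of A. -/
open Filter Topology NormedSpace

theorem norm_normedSpace_exp_le {A : Type*} [NormedRing A] [NormedAlgebra ℝ A] [CompleteSpace A]
    [NormOneClass A] (x : A) : ‖exp x‖ ≤ Real.exp ‖x‖ := by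
  rw [congrFun (exp_eq_tsum ℝ) x, Real.exp_eq_exp_ℝ, congrFun (exp_eq_tsum ℝ) ‖x‖]
  refine tsum_of_norm_bounded (expSeries_summable' (𝕂 := ℝ) ‖x‖).hasSum fun n ↦ ?_
  rw [norm_smul, smul_eq_mul, Real.norm_of_nonneg (by positivity)]
  gcongr
  exact norm_pow_le x n

theorem norm_pow_sub_pow_le_of_norm_le {A : Type*} [NormedRing A] [NormOneClass A] {u v : A}
    {M : ℝ} (hM : 1 ≤ M) (hu : ‖u‖ ≤ M) (hv : ‖v‖ ≤ M) (n : ℕ) :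
    ‖u ^ n - v ^ n‖ ≤ n * M ^ n * ‖u - v‖ := by
  induction n with
  | zero => simp
  | succ n ih =>
    have hu' : ‖u ^ n‖ ≤ M ^ n := (norm_pow_le u n).trans (by gcongr)
    calc ‖u ^ (n + 1) - v ^ (n + 1)‖ = ‖u ^ n * (u - v) + (u ^ n - v ^ n) * v‖ := by
          congr 1; noncomm_ring
      _ ≤ ‖u ^ n‖ * ‖u - v‖ + ‖u ^ n - v ^ n‖ * ‖v‖ :=
          (norm_add_le _ _).trans (add_le_add (norm_mul_le _ _) (norm_mul_le _ _))
      _ ≤ M ^ n * M * ‖u - v‖ + n * M ^ n * ‖u - v‖ * M := by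
          gcongr
          exact hu'.trans (le_mul_of_one_le_right (by positivity) hM)
      _ = (n + 1 : ℕ) * M ^ (n + 1) * ‖u - v‖ := by push_cast; ring

/-- The Lie–Trotter product formula. -/
theorem tendsto_exp_mul_exp_pow {A : Type*} [NormedRing A] [NormedAlgebra ℝ A] [CompleteSpace A]
    [NormOneClass A] (x y : A) :
    Tendsto (fun n : ℕ ↦ (exp ((n : ℝ)⁻¹ • x) * exp ((n : ℝ)⁻¹ • y)) ^ n) atTop
      (𝓝 (exp (x + y))) := by
  let _ : NormedAlgebra ℚ A := NormedAlgebra.restrictScalars ℚ ℝ A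
  set g : ℝ → A := fun t ↦ exp (t • x) * exp (t • y) - exp (t • (x + y)) with hg
  have hg0 : g 0 = 0 := by simp [hg]
  have hder : HasDerivAt g 0 0 := by
    have := ((hasDerivAt_exp_smul_const (𝕂 := ℝ) x 0).mul
      (hasDerivAt_exp_smul_const (𝕂 := ℝ) y 0)).sub
      (hasDerivAt_exp_smul_const (𝕂 := ℝ) (x + y) 0)
    exact this.congr_deriv (by simp)
  have hlim : Tendsto (fun n : ℕ ↦ (n : ℝ) * ‖g (n : ℝ)⁻¹‖) atTop (𝓝 0) := by
    have h1 : Tendsto (fun n : ℕ ↦ (n : ℝ)⁻¹) atTop (𝓝[≠] 0) := by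
      refine tendsto_nhdsWithin_iff.2 ⟨tendsto_inv_atTop_nhds_zero_nat, ?_⟩
      filter_upwards [eventually_gt_atTop 0] with n hn
      simp [hn.ne']
    have h2 := (hder.tendsto_slope.comp h1).norm
    simpa [Function.comp_def, slope_def_module, hg0, norm_smul] using h2
  rw [tendsto_iff_norm_sub_tendsto_zero]
  have hlim' := hlim.mul_const (Real.exp (‖x‖ + ‖y‖))
  rw [zero_mul] at hlim'
  refine squeeze_zero' (Eventually.of_forall fun _ ↦ norm_nonneg _) ?_ hlim'
  filter_upwards [eventually_gt_atTop 0] with n hn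
  have hn' : (n : ℝ) ≠ 0 := by positivity
  have hv : exp (x + y) = exp ((n : ℝ)⁻¹ • (x + y)) ^ n := by
    rw [← exp_nsmul, ← Nat.cast_smul_eq_nsmul ℝ, smul_smul, mul_inv_cancel₀ hn', one_smul]
  have hnorm (z : A) : ‖(n : ℝ)⁻¹ • z‖ = ‖z‖ / n := by
    rw [norm_smul, norm_inv, Real.norm_natCast]; ring
  have hb := norm_pow_sub_pow_le_of_norm_le (u := exp ((n : ℝ)⁻¹ • x) * exp ((n : ℝ)⁻¹ • y))
    (v := exp ((n : ℝ)⁻¹ • (x + y))) (M := Real.exp ((‖x‖ + ‖y‖) / n))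
    (Real.one_le_exp (by positivity)) ?_ ?_ n
  · rw [hv]
    refine hb.trans_eq ?_
    rw [← Real.exp_nat_mul, mul_div_cancel₀ _ hn']
    ring
  · refine (norm_mul_le _ _).trans ?_
    rw [add_div, Real.exp_add, ← hnorm, ← hnorm]
    gcongr <;> exact norm_normedSpace_exp_le _
  · refine (norm_normedSpace_exp_le _).trans ?_
    rw [hnorm]
    gcongr
    exact norm_add_le x y

/-- A map which is additive on a ball around `0` extends to an additive map. -/
theorem exists_addMonoidHom_eqOn_closedBall {E F : Type*} [NormedAddCommGroup E]
    [NormedSpace ℝ E] [AddCommGroup F] {L : E → F} {δ : ℝ} (hδ : 0 < δ)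
    (hL : ∀ x y, ‖x‖ ≤ δ → ‖y‖ ≤ δ → ‖x + y‖ ≤ δ → L (x + y) = L x + L y) :
    ∃ Φ : E →+ F, ∀ x, ‖x‖ ≤ δ → Φ x = L x := by
  have h0 : L 0 = 0 := by simpa using hL 0 0 (by simp [hδ.le]) (by simp [hδ.le]) (by simp [hδ.le])
  have hnorm (n : ℕ) (z : E) : ‖n • z‖ = n * ‖z‖ := by
    rw [← Nat.cast_smul_eq_nsmul ℝ, norm_smul, Real.norm_natCast]
  have hsmul (z : E) (n : ℕ) (hn : ‖n • z‖ ≤ δ) : L (n • z) = n • L z := by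
    induction n with
    | zero => simp [h0]
    | succ n ih =>
      rw [hnorm] at hn
      push_cast at hn
      have hz := norm_nonneg z
      have h1 : ‖n • z‖ ≤ δ := by rw [hnorm]; nlinarith
      have h2 : ‖z‖ ≤ δ := by nlinarith [mul_nonneg n.cast_nonneg hz]
      rw [succ_nsmul, succ_nsmul, hL _ _ h1 h2 (by rw [← succ_nsmul, hnorm]; push_cast; exact hn),
        ih h1]
  have hex (x : E) : ∃ n : ℕ, 0 < n ∧ ‖x‖ ≤ n * δ := by
    obtain ⟨n, hn⟩ := exists_nat_gt (‖x‖ / δ)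
    refine ⟨n, ?_, ((div_lt_iff₀ hδ).1 hn).le⟩
    exact_mod_cast (div_nonneg (norm_nonneg x) hδ.le).trans_lt hn
  choose N hN0 hN using hex
  have hdiv {x : E} {n : ℕ} (hn : 0 < n) (hx : ‖x‖ ≤ n * δ) : ‖(n : ℝ)⁻¹ • x‖ ≤ δ := by
    rw [norm_smul, norm_inv, Real.norm_natCast, inv_mul_le_iff₀ (by positivity)]
    exact hx
  have hindep {x : E} {n m : ℕ} (hn : 0 < n) (hm : 0 < m) (hxn : ‖x‖ ≤ n * δ)
      (hxm : ‖x‖ ≤ m * δ) : n • L ((n : ℝ)⁻¹ • x) = m • L ((m : ℝ)⁻¹ • x) := by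
    have hn' : (n : ℝ) ≠ 0 := by positivity
    have hm' : (m : ℝ) ≠ 0 := by positivity
    set z := ((n : ℝ)⁻¹ * (m : ℝ)⁻¹) • x
    have e1 : (n : ℝ)⁻¹ • x = m • z := by
      rw [← Nat.cast_smul_eq_nsmul ℝ, smul_smul]; congr 1; field_simp
    have e2 : (m : ℝ)⁻¹ • x = n • z := by
      rw [← Nat.cast_smul_eq_nsmul ℝ, smul_smul]; congr 1; field_simp
    rw [e1, e2, hsmul z m (e1 ▸ hdiv hn hxn), hsmul z n (e2 ▸ hdiv hm hxm), smul_smul, smul_smul,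
      mul_comm]
  refine ⟨AddMonoidHom.mk' (fun x ↦ N x • L ((N x : ℝ)⁻¹ • x)) fun x y ↦ ?_, fun x hx ↦ ?_⟩
  · set n := N x + N y + N (x + y)
    have hn : 0 < n := by have := hN0 x; omega
    have key (w : E) (hw : N w ≤ n) : N w • L ((N w : ℝ)⁻¹ • w) = n • L ((n : ℝ)⁻¹ • w) ∧
        ‖(n : ℝ)⁻¹ • w‖ ≤ δ := by
      have : ‖w‖ ≤ n * δ := (hN w).trans (by gcongr)
      exact ⟨hindep (hN0 w) hn (hN w) this, hdiv hn this⟩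
    obtain ⟨ex, bx⟩ := key x (by omega)
    obtain ⟨ey, bY⟩ := key y (by omega)
    obtain ⟨es, bs⟩ := key (x + y) (by omega)
    rw [smul_add] at bs
    rw [ex, ey, es, smul_add, hL _ _ bx bY bs, smul_add]
  · simpa using hindep (hN0 x) one_pos (hN x) (by simpa using hx)

/-- A continuous multiplicative functional whose value at each element lies in its spectrum. -/
structure IsSpectralMultiplicative {A : Type*} [CStarAlgebra A] (f : A → ℂ) : Prop where
  continuous : Continuous f
  map_mul : ∀ x y, f (x * y) = f x * f y
  mem_spectrum : ∀ x, f x ∈ spectrum ℂ x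

namespace IsSpectralMultiplicative

variable {A : Type*} [CStarAlgebra A] {f : A → ℂ}

theorem nontrivial (hf : IsSpectralMultiplicative f) : Nontrivial A := by
  by_contra h
  rw [not_nontrivial_iff_subsingleton] at h
  simpa using hf.mem_spectrum 0

theorem map_algebraMap (hf : IsSpectralMultiplicative f) (c : ℂ) : f (algebraMap ℂ A c) = c := by
  have := hf.nontrivial
  simpa using hf.mem_spectrum (algebraMap ℂ A c)

theorem map_one (hf : IsSpectralMultiplicative f) : f 1 = 1 := by
  simpa using hf.map_algebraMap 1

theorem norm_le (hf : IsSpectralMultiplicative f) (x : A) : ‖f x‖ ≤ ‖x‖ :=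
  have := hf.nontrivial
  spectrum.norm_le_norm_of_mem (hf.mem_spectrum x)

theorem map_pow (hf : IsSpectralMultiplicative f) (x : A) (n : ℕ) : f (x ^ n) = f x ^ n := by
  induction n with
  | zero => simp [hf.map_one]
  | succ n ih => rw [pow_succ, pow_succ, hf.map_mul, ih]

theorem map_exp_ne_zero (hf : IsSpectralMultiplicative f) (x : A) : f (exp x) ≠ 0 := by
  let _ : NormedAlgebra ℚ A := NormedAlgebra.restrictScalars ℚ ℝ A
  intro h
  have := hf.mem_spectrum (exp x)
  rw [h, spectrum.zero_mem_iff] at this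
  exact this (isUnit_exp x)

theorem map_exp_add (hf : IsSpectralMultiplicative f) (x y : A) :
    f (exp (x + y)) = f (exp x) * f (exp y) := by
  have := hf.nontrivial
  let _ : NormedAlgebra ℚ A := NormedAlgebra.restrictScalars ℚ ℝ A
  refine tendsto_nhds_unique ((hf.continuous.tendsto _).comp (tendsto_exp_mul_exp_pow x y)) ?_
  refine tendsto_const_nhds.congr' ?_
  filter_upwards [eventually_gt_atTop 0] with n hn
  have h (z : A) : f (exp z) = f (exp ((n : ℝ)⁻¹ • z)) ^ n := by
    rw [← hf.map_pow, ← exp_nsmul, ← Nat.cast_smul_eq_nsmul ℝ, smul_smul,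
      mul_inv_cancel₀ (by positivity), one_smul]
  rw [Function.comp_apply, hf.map_pow, hf.map_mul, mul_pow, ← h, ← h]

/-- The logarithm of `f ∘ exp`, as a globally defined additive functional. -/
theorem exists_additive_log (hf : IsSpectralMultiplicative f) :
    ∃ Φ : A →+ ℂ, (∀ x, f (exp x) = Complex.exp (Φ x)) ∧
      ∀ x, IsStarNormal x → Φ x ∈ spectrum ℂ x := by
  have := hf.nontrivial
  let _ : NormedAlgebra ℚ A := NormedAlgebra.restrictScalars ℚ ℝ A
  have hlog : ContinuousAt (fun x : A ↦ (f (exp x)).arg) 0 := by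
    refine ContinuousAt.comp (g := Complex.arg) (Complex.continuousAt_arg ?_)
      (hf.continuous.comp exp_continuous).continuousAt
    simp [hf.map_one, Complex.one_mem_slitPlane]
  obtain ⟨ε, hε, hball⟩ := Metric.continuousAt_iff.1 hlog 1 one_pos
  simp only [exp_zero, hf.map_one, Complex.arg_one, dist_zero_right, Real.norm_eq_abs] at hball
  set δ := min (ε / 2) 1
  have hδ : 0 < δ := by positivity
  have harg (x : A) (hx : ‖x‖ ≤ δ) : |(f (exp x)).arg| < 1 :=
    hball ((hx.trans (min_le_left _ _)).trans_lt (half_lt_self hε))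
  have hπ := Real.pi_gt_three
  obtain ⟨Φ, hΦ⟩ := exists_addMonoidHom_eqOn_closedBall (L := fun x : A ↦ (f (exp x)).log) hδ
    fun x y hx hy _ ↦ by
      have h1 := abs_lt.1 (harg x hx)
      have h2 := abs_lt.1 (harg y hy)
      rw [hf.map_exp_add]
      exact Complex.log_mul (hf.map_exp_ne_zero x) (hf.map_exp_ne_zero y)
        ⟨by linarith, by linarith⟩
  have hscale (x : A) : ∃ (n : ℕ) (z : A), 0 < n ∧ ‖z‖ ≤ δ ∧ z = ((n : ℂ)⁻¹) • x ∧ x = n • z := by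
    obtain ⟨n, hn⟩ := exists_nat_gt (‖x‖ / δ)
    have hn0 : 0 < n := by exact_mod_cast (div_nonneg (norm_nonneg x) hδ.le).trans_lt hn
    refine ⟨n, (n : ℂ)⁻¹ • x, hn0, ?_, rfl, ?_⟩
    · rw [norm_smul, norm_inv, Complex.norm_natCast, inv_mul_le_iff₀ (by positivity)]
      exact ((div_lt_iff₀ hδ).1 hn).le
    · rw [← Nat.cast_smul_eq_nsmul ℂ, smul_smul,
        mul_inv_cancel₀ (Nat.cast_ne_zero.2 hn0.ne'), one_smul]
  refine ⟨Φ, fun x ↦ ?_, fun x hx ↦ ?_⟩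
  · obtain ⟨n, z, -, hz, -, rfl⟩ := hscale x
    rw [exp_nsmul, hf.map_pow, map_nsmul, hΦ z hz, nsmul_eq_mul, Complex.exp_nat_mul,
      Complex.exp_log (hf.map_exp_ne_zero z)]
  · obtain ⟨n, z, hn, hz, hzx, hxz⟩ := hscale x
    have hzn : IsStarNormal z := by
      rw [hzx]; infer_instance
    have hmem : Φ z ∈ spectrum ℂ z := by
      have h := hf.mem_spectrum (exp z)
      rw [← CFC.complex_exp_eq_normedSpace_exp hzn, cfc_map_spectrum Complex.exp z,
        CFC.complex_exp_eq_normedSpace_exp hzn] at h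
      obtain ⟨w, hw, hwe⟩ := h
      have hw1 : |w.im| ≤ 1 := (Complex.abs_im_le_norm w).trans
        ((spectrum.norm_le_norm_of_mem hw).trans (hz.trans (min_le_right _ _)))
      have := abs_le.1 hw1
      rwa [hΦ z hz, ← hwe, Complex.log_exp (by linarith) (by linarith)]
    rw [hxz, map_nsmul, ← Nat.cast_smul_eq_nsmul ℂ, ← Nat.cast_smul_eq_nsmul ℂ]
    exact spectrum.smul_mem_smul_iff (r := Units.mk0 (n : ℂ) (Nat.cast_ne_zero.2 hn.ne')) |>.2 hmem


section Additive

variable {Φ : A →+ ℂ}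

theorem additive_apply_eq_re (hΦ : ∀ x, IsStarNormal x → Φ x ∈ spectrum ℂ x) {a : A}
    (ha : IsSelfAdjoint a) : Φ a = ((Φ a).re : ℂ) :=
  ha.mem_spectrum_eq_re (hΦ a ha.isStarNormal)

theorem additive_apply_re_mem (hΦ : ∀ x, IsStarNormal x → Φ x ∈ spectrum ℂ x) {a : A}
    (ha : IsSelfAdjoint a) : (Φ a).re ∈ spectrum ℝ a := by
  rw [← spectrum.algebraMap_mem_iff ℂ, Complex.coe_algebraMap, ← additive_apply_eq_re hΦ ha]
  exact hΦ a ha.isStarNormal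

theorem additive_apply_I_smul (hΦ : ∀ x, IsStarNormal x → Φ x ∈ spectrum ℂ x) {a : A}
    (ha : IsSelfAdjoint a) : Φ (Complex.I • a) = Complex.I * Φ a := by
  have hn := ha.isStarNormal
  have key (u : ℂˣ) : ∃ w : ℝ, Φ ((u : ℂ) • a) = u * w := by
    have h := hΦ ((u : ℂ) • a) inferInstance
    have h' : (u : ℂ) * (↑u⁻¹ * Φ ((u : ℂ) • a)) = Φ ((u : ℂ) • a) := by
      rw [← mul_assoc, u.mul_inv, one_mul]
    rw [← h'] at h
    have := spectrum.smul_mem_smul_iff (r := u) |>.1 h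
    exact ⟨_, by rw [← ha.mem_spectrum_eq_re this, h']⟩
  obtain ⟨v, hv⟩ := key (Units.mk0 Complex.I Complex.I_ne_zero)
  obtain ⟨w, hw⟩ := key (Units.mk0 (1 + Complex.I) fun h ↦ by simpa using congrArg Complex.re h)
  simp only [Units.val_mk0] at hv hw
  rw [add_smul, one_smul, map_add, hv, additive_apply_eq_re hΦ ha] at hw
  have h1 := congrArg Complex.re hw
  have h2 := congrArg Complex.im hw
  simp at h1 h2
  rw [hv, additive_apply_eq_re hΦ ha, h1, h2]

theorem additive_apply_cfc (hΦ : ∀ x, IsStarNormal x → Φ x ∈ spectrum ℂ x) {a : A}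
    (ha : IsSelfAdjoint a) (k : ℝ → ℝ) (hk : ContinuousOn k (spectrum ℝ a)) :
    Φ (cfc k a) = (k (Φ a).re : ℂ) := by
  have hn := ha.isStarNormal
  have hre : ContinuousOn (fun z : ℂ ↦ (k z.re : ℂ)) (spectrum ℂ a) := by
    refine Complex.continuous_ofReal.comp_continuousOn
      (hk.comp Complex.continuous_re.continuousOn fun z hz ↦ ?_)
    rw [← spectrum.algebraMap_mem_iff ℂ, Complex.coe_algebraMap, ← ha.mem_spectrum_eq_re hz]
    exact hz
  have hsum : a + Complex.I • cfc k a = cfc (fun z : ℂ ↦ z + Complex.I * (k z.re : ℂ)) a := by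
    rw [cfc_add (fun z : ℂ ↦ z) (fun z ↦ Complex.I * (k z.re : ℂ)) (a := a),
      cfc_const_mul Complex.I (fun z : ℂ ↦ (k z.re : ℂ)) a, cfc_id' ℂ a, cfc_real_eq_complex k ha]
  have hmem := hΦ (a + Complex.I • cfc k a) (hsum ▸ cfc_predicate _ a)
  rw [map_add, additive_apply_I_smul hΦ (cfc_predicate k a), hsum,
    cfc_map_spectrum (fun z : ℂ ↦ z + Complex.I * (k z.re : ℂ)) a] at hmem
  obtain ⟨z, hz, h⟩ := hmem
  have hz' := ha.mem_spectrum_eq_re hz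
  rw [additive_apply_eq_re hΦ ha, additive_apply_eq_re hΦ (cfc_predicate k a)] at h
  rw [additive_apply_eq_re hΦ (cfc_predicate k a)]
  have h1 := congrArg Complex.re h
  have h2 := congrArg Complex.im h
  have h3 := congrArg Complex.im hz'
  simp at h1 h2 h3
  rw [h3, zero_add] at h2
  rw [← h1, h2]

theorem additive_apply_mul_self (hΦ : ∀ x, IsStarNormal x → Φ x ∈ spectrum ℂ x) {a : A}
    (ha : IsSelfAdjoint a) : Φ (a * a) = Φ a * Φ a := by
  have := additive_apply_cfc hΦ ha (fun t ↦ t * t) (by fun_prop)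
  rw [cfc_mul (fun t : ℝ ↦ t) (fun t ↦ t) a, cfc_id' ℝ a] at this
  rw [this, additive_apply_eq_re hΦ ha]
  simp

theorem additive_apply_star_mul_self_add (hΦ : ∀ x, IsStarNormal x → Φ x ∈ spectrum ℂ x) (x : A) :
    Φ (star x * x + x * star x) = 2 * (‖Φ x‖ : ℂ) ^ 2 := by
  obtain ⟨a, b, ha, hb, rfl⟩ : ∃ a b : A, IsSelfAdjoint a ∧ IsSelfAdjoint b ∧
      x = a + Complex.I • b :=
    ⟨realPart x, imaginaryPart x, (realPart x).2, (imaginaryPart x).2,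
      (realPart_add_I_smul_imaginaryPart x).symm⟩
  have h : star (a + Complex.I • b) * (a + Complex.I • b) +
      (a + Complex.I • b) * star (a + Complex.I • b) = 2 • (a * a + b * b) := by
    simp only [star_add, star_smul, ha.star_eq, hb.star_eq, Complex.star_def, Complex.conj_I,
      mul_add, add_mul, smul_mul_assoc, mul_smul_comm, neg_smul, neg_mul, mul_neg]
    match_scalars <;> simp <;> norm_num
  rw [h, map_nsmul, map_add, map_add, additive_apply_mul_self hΦ ha,
    additive_apply_mul_self hΦ hb, additive_apply_I_smul hΦ hb, additive_apply_eq_re hΦ ha,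
    additive_apply_eq_re hΦ hb, ← Complex.ofReal_pow, Complex.sq_norm, mul_comm Complex.I,
    Complex.normSq_add_mul_I]
  push_cast
  ring

theorem map_eq_additive_of_spectrum_nonneg (hf : IsSpectralMultiplicative f)
    (hexp : ∀ x, f (exp x) = Complex.exp (Φ x))
    (hΦ : ∀ x, IsStarNormal x → Φ x ∈ spectrum ℂ x) {b : A} (hb : IsSelfAdjoint b)
    (hpos : ∀ t ∈ spectrum ℝ b, 0 ≤ t) : f b = Φ b := by
  have hβ : 0 ≤ (Φ b).re := hpos _ (additive_apply_re_mem hΦ hb)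
  have key (ε : ℝ) (hε : 0 < ε) : f (b + algebraMap ℝ A ε) = Φ b + ε := by
    have hcont : ContinuousOn (fun t ↦ Real.log (t + ε)) (spectrum ℝ b) :=
      ContinuousOn.log (by fun_prop) fun t ht ↦ by linarith [hpos t ht]
    have h : b + algebraMap ℝ A ε = exp (cfc (fun t ↦ Real.log (t + ε)) b) := by
      rw [← CFC.real_exp_eq_normedSpace_exp (cfc_predicate _ b),
        ← cfc_comp' Real.exp (fun t ↦ Real.log (t + ε)) b,
        cfc_congr (g := fun t ↦ t + ε) fun t ht ↦ Real.exp_log (by linarith [hpos t ht]),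
        cfc_add_const ε (fun t : ℝ ↦ t) b, cfc_id' ℝ b]
    rw [h, hexp, additive_apply_cfc hΦ hb _ hcont, ← Complex.ofReal_exp,
      Real.exp_log (by linarith), Complex.ofReal_add, ← additive_apply_eq_re hΦ hb]
  have h1 : Tendsto (fun ε : ℝ ↦ f (b + algebraMap ℝ A ε)) (𝓝[>] 0) (𝓝 (f b)) := by
    have : Continuous fun ε : ℝ ↦ f (b + algebraMap ℝ A ε) :=
      hf.continuous.comp (continuous_const.add (continuous_algebraMap ℝ A))
    simpa using (this.tendsto 0).mono_left nhdsWithin_le_nhds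
  have h2 : Tendsto (fun ε : ℝ ↦ Φ b + ε) (𝓝[>] 0) (𝓝 (Φ b)) := by
    have : Continuous fun ε : ℝ ↦ Φ b + (ε : ℂ) := by fun_prop
    simpa using (this.tendsto 0).mono_left nhdsWithin_le_nhds
  refine tendsto_nhds_unique h1 (h2.congr' ?_)
  filter_upwards [self_mem_nhdsWithin] with ε hε using (key ε hε).symm

theorem additive_star_mul_self (hf : IsSpectralMultiplicative f)
    (hexp : ∀ x, f (exp x) = Complex.exp (Φ x))
    (hΦ : ∀ x, IsStarNormal x → Φ x ∈ spectrum ℂ x) (x : A) :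
    Φ (star x * x) = (‖Φ x‖ : ℂ) ^ 2 ∧ f (star x) * f x = (‖Φ x‖ : ℂ) ^ 2 := by
  have h1 : f (star x * x) = Φ (star x * x) := hf.map_eq_additive_of_spectrum_nonneg hexp hΦ
    (.star_mul_self x) spectrum_star_mul_self_nonneg
  have h2 : f (x * star x) = Φ (x * star x) := by
    refine hf.map_eq_additive_of_spectrum_nonneg hexp hΦ (.mul_star_self x) ?_
    simpa using spectrum_star_mul_self_nonneg (b := star x)
  have h3 := additive_apply_star_mul_self_add hΦ x
  rw [map_add, ← h1, ← h2, hf.map_mul, hf.map_mul, mul_comm (f x)] at h3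
  rw [← h1, hf.map_mul, and_self]
  linear_combination h3 / 2

/-- Compressing by `(1 + n y⋆y)⁻¹`, on which `f` takes the value `1`, makes `y` small. -/
theorem exists_compression (hf : IsSpectralMultiplicative f)
    (hexp : ∀ x, f (exp x) = Complex.exp (Φ x))
    (hΦ : ∀ x, IsStarNormal x → Φ x ∈ spectrum ℂ x) {y : A} (hy : Φ y = 0) {ε : ℝ} (hε : 0 < ε) :
    ∃ e : A, f e = 1 ∧ ‖e - algebraMap ℝ A 2⁻¹‖ ≤ 2⁻¹ ∧ ‖y * e‖ ≤ ε := by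
  obtain ⟨r, hr, hrε⟩ : ∃ r : ℝ, 0 < r ∧ 1 / r = ε ^ 2 := ⟨1 / ε ^ 2, by positivity, by simp⟩
  obtain ⟨p, hp⟩ : ∃ p, p = star y * y := ⟨_, rfl⟩
  have hpsa : IsSelfAdjoint p := hp ▸ .star_mul_self y
  have hpos : ∀ t ∈ spectrum ℝ p, 0 ≤ t := hp ▸ spectrum_star_mul_self_nonneg
  have hk : ContinuousOn (fun t ↦ (1 + r * t)⁻¹) (spectrum ℝ p) := by
    refine ContinuousOn.inv₀ (by fun_prop) fun t ht ↦ ?_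
    have := mul_nonneg hr.le (hpos t ht)
    positivity
  have hk' : ContinuousOn (fun t ↦ (1 + r * t)⁻¹ * t) (spectrum ℝ p) := hk.mul continuousOn_id
  have hesa : IsSelfAdjoint (cfc (fun t ↦ (1 + r * t)⁻¹) p) := cfc_predicate _ p
  refine ⟨cfc (fun t ↦ (1 + r * t)⁻¹) p, ?_, ?_, ?_⟩
  · rw [hf.map_eq_additive_of_spectrum_nonneg hexp hΦ hesa, additive_apply_cfc hΦ hpsa _ hk, hp,
      (hf.additive_star_mul_self hexp hΦ y).1, hy]
    · simp
    · rw [cfc_map_spectrum (fun t ↦ (1 + r * t)⁻¹) p hpsa hk]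
      rintro _ ⟨t, ht, rfl⟩
      have := mul_nonneg hr.le (hpos t ht)
      positivity
  · rw [← cfc_const (2⁻¹ : ℝ) p hpsa,
      ← cfc_sub (fun t ↦ (1 + r * t)⁻¹) (fun _ ↦ 2⁻¹) p hk continuousOn_const]
    refine norm_cfc_le (by norm_num) fun t ht ↦ ?_
    have h0 := mul_nonneg hr.le (hpos t ht)
    have h1 : (1 + r * t)⁻¹ ≤ 1 := inv_le_one_of_one_le₀ (by linarith)
    have h2 : 0 ≤ (1 + r * t)⁻¹ := by positivity
    rw [Real.norm_eq_abs, abs_le]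
    constructor <;> linarith
  · rw [← sq_le_sq₀ (norm_nonneg _) hε.le, sq, ← CStarRing.norm_star_mul_self, star_mul,
      hesa.star_eq]
    have h : cfc (fun t ↦ (1 + r * t)⁻¹) p * star y * (y * cfc (fun t ↦ (1 + r * t)⁻¹) p) =
        cfc (fun t ↦ (1 + r * t)⁻¹ * t * (1 + r * t)⁻¹) p := by
      rw [cfc_mul (fun t ↦ (1 + r * t)⁻¹ * t) (fun t ↦ (1 + r * t)⁻¹) p hk' hk,
        cfc_mul (fun t ↦ (1 + r * t)⁻¹) (fun t ↦ t) p hk continuousOn_id, cfc_id' ℝ p hpsa]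
      nth_rw 4 [hp]
      simp only [mul_assoc]
    rw [h, ← hrε]
    refine norm_cfc_le (by positivity) fun t ht ↦ ?_
    have ht := hpos t ht
    have h0 := mul_nonneg hr.le ht
    rw [Real.norm_of_nonneg (by positivity), ← div_eq_inv_mul, ← div_eq_mul_inv, div_div,
      div_le_div_iff₀ (by positivity) hr]
    nlinarith

theorem norm_map_sub_half_le (hf : IsSpectralMultiplicative f)
    (hexp : ∀ x, f (exp x) = Complex.exp (Φ x))
    (hΦ : ∀ x, IsStarNormal x → Φ x ∈ spectrum ℂ x) (x : A) :
    ‖f x - Φ x / 2‖ ≤ ‖Φ x‖ / 2 := by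
  have := hf.nontrivial
  set c := Φ x
  have hc : Φ (algebraMap ℂ A c) = c := by
    have h : IsStarNormal (algebraMap ℂ A c) := by
      rw [Algebra.algebraMap_eq_smul_one]; infer_instance
    simpa using hΦ _ h
  refine le_of_forall_pos_le_add fun ε hε ↦ ?_
  obtain ⟨e, he, he', hye⟩ := hf.exists_compression hexp hΦ (y := x - algebraMap ℂ A c)
    (by rw [map_sub, hc, sub_self]) hε
  have hfx : f x = f (x * e) := by rw [hf.map_mul, he, mul_one]
  have hmem : f x - c / 2 ∈ spectrum ℂ (x * e - algebraMap ℂ A (c / 2)) := by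
    rw [hfx, ← spectrum.sub_singleton_eq]
    exact Set.sub_mem_sub (hf.mem_spectrum _) rfl
  have hdec : x * e - algebraMap ℂ A (c / 2) =
      c • (e - algebraMap ℝ A 2⁻¹) + (x - algebraMap ℂ A c) * e := by
    have : algebraMap ℝ A 2⁻¹ = (2⁻¹ : ℂ) • (1 : A) := by
      rw [IsScalarTower.algebraMap_apply ℝ ℂ A, Algebra.algebraMap_eq_smul_one]
      simp
    rw [this, Algebra.algebraMap_eq_smul_one, Algebra.algebraMap_eq_smul_one, sub_mul,
      smul_one_mul, smul_sub, smul_smul, div_eq_mul_inv]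
    abel
  refine (spectrum.norm_le_norm_of_mem hmem).trans ?_
  rw [hdec]
  refine (norm_add_le _ _).trans (add_le_add ?_ hye)
  rw [norm_smul, div_eq_mul_inv]
  gcongr

theorem map_eq_additive (hf : IsSpectralMultiplicative f)
    (hexp : ∀ x, f (exp x) = Complex.exp (Φ x))
    (hΦ : ∀ x, IsStarNormal x → Φ x ∈ spectrum ℂ x) (x : A) : f x = Φ x := by
  have h1 := hf.norm_map_sub_half_le hexp hΦ x
  have h2 := hf.norm_map_sub_half_le hexp hΦ (star x)
  have h3 := (hf.additive_star_mul_self hexp hΦ x).2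
  have h4 := (hf.additive_star_mul_self hexp hΦ (star x)).2
  rw [star_star, mul_comm, h3] at h4
  have h4' : ‖Φ x‖ = ‖Φ (star x)‖ := by
    rw [← sq_eq_sq₀ (norm_nonneg _) (norm_nonneg _)]
    exact_mod_cast h4
  have h3' : ‖f (star x)‖ * ‖f x‖ = ‖Φ x‖ ^ 2 := by
    rw [← norm_mul, h3]
    simp
  have hstar : ‖f (star x)‖ ≤ ‖Φ x‖ := by
    have := norm_le_norm_add_norm_sub' (f (star x)) (Φ (star x) / 2)
    rw [norm_div, Complex.norm_ofNat] at this
    linarith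
  have hge : ‖Φ x‖ ≤ ‖f x‖ := by
    rcases (norm_nonneg (Φ x)).eq_or_lt with h | h
    · rw [← h]; exact norm_nonneg _
    · have := mul_le_mul_of_nonneg_right hstar (norm_nonneg (f x))
      nlinarith
  have e1 : ‖f x - Φ x / 2‖ ^ 2 ≤ (‖Φ x‖ / 2) ^ 2 := by gcongr
  have e2 : ‖Φ x‖ ^ 2 ≤ ‖f x‖ ^ 2 := by gcongr
  rw [← sub_eq_zero, ← norm_eq_zero, ← sq_eq_zero_iff]
  refine le_antisymm ?_ (sq_nonneg _)
  have e3 : ‖f x - Φ x‖ ^ 2 = 2 * ‖f x - Φ x / 2‖ ^ 2 - 2 * (‖Φ x‖ / 2) ^ 2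
      + ‖Φ x‖ ^ 2 - ‖f x‖ ^ 2 := by
    simp only [div_pow, Complex.sq_norm, Complex.normSq_apply, Complex.sub_re, Complex.sub_im,
      Complex.div_ofNat_re, Complex.div_ofNat_im]
    ring
  linarith

end Additive

theorem map_add (hf : IsSpectralMultiplicative f) (x y : A) : f (x + y) = f x + f y := by
  obtain ⟨Φ, hexp, hΦ⟩ := hf.exists_additive_log
  simp only [hf.map_eq_additive hexp hΦ, _root_.map_add]

theorem map_smul (hf : IsSpectralMultiplicative f) (l : ℂ) (x : A) : f (l • x) = l * f x := by
  rw [Algebra.smul_def, hf.map_mul, hf.map_algebraMap]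

end IsSpectralMultiplicative
/-- Corollary 4.4 of the paper (Brits–Mabrouk–Touré): a continuous
multiplicative spectral-valued functional on a unital C*-algebra is ℂ-linear,
hence a character. -/
theorem continuous_spectral_multiplicative_functional_linear_cstar
    {A : Type*} [NormedRing A] [StarRing A] [CStarRing A] [CompleteSpace A]
    [NormedAlgebra ℂ A] [StarModule ℂ A]
    (f : A → ℂ)
    (hcont : Continuous f)
    (hmul : ∀ x y : A, f (x * y) = f x * f y)
    (hspec : ∀ x : A, f x ∈ spectrum ℂ x) :
    (∀ x y : A, f (x + y) = f x + f y) ∧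
    (∀ (l : ℂ) (x : A), f (l • x) = l * f x) ∧ f ≠ 0 := by
  let _ : CStarAlgebra A := {}
  have hf : IsSpectralMultiplicative f := ⟨hcont, hmul, hspec⟩
  exact ⟨hf.map_add, hf.map_smul, fun h ↦ by simpa [h] using hf.map_one⟩
end

section
/- Let A be a complex Banach algebra and let φ : A → ℂ be an ℝ-linear functional (additive and homogeneous for real scalars) such that φ(a) ∈ σ(a) for every a ∈ A. Then φ is ℂ-linear, i.e. φ(λa) = λ·φ(a) for all λ ∈ ℂ and a ∈ A. -/
open ComplexConjugate in
/-- A bounded `ℝ`-linear map into `ℂ` is the sum of a `ℂ`-linear and a conjugate-linear one. -/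
theorem exists_clm_add_conj_clm {E : Type*} [NormedAddCommGroup E] [NormedSpace ℂ E]
    (φ : E →ₗ[ℝ] ℂ) (C : ℝ) (hC : ∀ a, ‖φ a‖ ≤ C * ‖a‖) :
    ∃ f g : E →L[ℂ] ℂ, ∀ a, φ a = f a + conj (g a) := by
  have key : ∀ ψ : E →ₗ[ℝ] ℂ, (∀ a, ‖ψ a‖ ≤ C * ‖a‖) →
      ∃ f : E →L[ℂ] ℂ, ∀ a, f a = (ψ a - Complex.I * ψ (Complex.I • a)) / 2 := by
    intro ψ hψ
    have hsmul : ∀ (l : ℂ) (a : E),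
        ψ (l • a) = l.re * ψ a + l.im * ψ (Complex.I • a) := by
      intro l a
      have h : l • a = l.re • a + l.im • (Complex.I • a) := by
        conv_lhs => rw [← Complex.re_add_im l]
        rw [add_smul, mul_smul, Complex.coe_smul, Complex.coe_smul]
      rw [h, map_add, map_smul, map_smul, Complex.real_smul, Complex.real_smul]
    refine ⟨LinearMap.mkContinuous
      { toFun := fun a => (ψ a - Complex.I * ψ (Complex.I • a)) / 2
        map_add' := fun a b => by rw [smul_add, map_add, map_add]; ring
        map_smul' := fun l a => by
          rw [smul_smul, hsmul l, hsmul (Complex.I * l), RingHom.id_apply, smul_eq_mul]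
          simp only [Complex.I_mul_re, Complex.I_mul_im, Complex.ofReal_neg]
          linear_combination (l.im * ψ (Complex.I • a) / 2) * Complex.I_sq +
            (ψ a - Complex.I * ψ (Complex.I • a)) / 2 * Complex.re_add_im l } C ?_, fun a => rfl⟩
    intro a
    have h₁ := hψ a
    have h₂ := hψ (Complex.I • a)
    rw [norm_smul, Complex.norm_I, one_mul] at h₂
    have h₃ := norm_sub_le (ψ a) (Complex.I * ψ (Complex.I • a))
    rw [norm_mul, Complex.norm_I, one_mul] at h₃
    simp only [LinearMap.coe_mk, AddHom.coe_mk, norm_div, Complex.norm_ofNat]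
    linarith
  obtain ⟨f, hf⟩ := key φ hC
  obtain ⟨g, hg⟩ := key (Complex.conjLIE.toLinearEquiv.toLinearMap ∘ₗ φ) fun a => by
    simpa using hC a
  refine ⟨f, g, fun a => ?_⟩
  rw [hf, hg]
  have h₂ : conj (2 : ℂ) = 2 := Complex.conj_ofNat 2
  simp [h₂]
  ring

open ComplexConjugate in
theorem Complex.exists_mul_add_conj_mul_eq_zero {p q : ℂ} (h : ‖p‖ = ‖q‖) :
    ∃ l : ℂ, l ≠ 0 ∧ l * p + conj (l * q) = 0 := by
  by_cases hp : p = 0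
  · have hq : q = 0 := by simpa [hp] using h.symm
    exact ⟨1, one_ne_zero, by simp [hp, hq]⟩
  obtain ⟨l, hl⟩ := IsAlgClosed.exists_pow_nat_eq (-conj q / p) (n := 2) two_pos
  have hnorm : ‖l‖ = 1 := by
    have h₁ : ‖l‖ ^ 2 = 1 := by
      rw [← norm_pow, hl, norm_div, norm_neg, RCLike.norm_conj, ← h,
        div_self (norm_ne_zero_iff.mpr hp)]
    exact (pow_eq_one_iff_of_nonneg (norm_nonneg l) two_ne_zero).mp h₁
  have hl0 : l ≠ 0 := norm_ne_zero_iff.mp (by rw [hnorm]; exact one_ne_zero)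
  refine ⟨l, hl0, ?_⟩
  have hconj : l * conj l = 1 := by
    rw [Complex.mul_conj, Complex.normSq_eq_norm_sq, hnorm]; simp
  rw [eq_div_iff hp] at hl
  apply mul_left_cancel₀ hl0
  rw [map_mul]
  linear_combination hl + conj q * hconj

/-- If `g` is dominated by `f` on the one-parameter group generated by `b`, and `g` vanishes at `1`,
then `g b = 0`, by Liouville's theorem. -/
theorem ContinuousLinearMap.apply_eq_zero_of_norm_lt_on_exp {A : Type*} [NormedRing A]
    [NormedAlgebra ℂ A] [CompleteSpace A] (f g : A →L[ℂ] ℂ) (b : A) (hg : g 1 = 0)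
    (h : ∀ z : ℂ, ‖g (NormedSpace.exp (z • b))‖ < ‖f (NormedSpace.exp (z • b))‖) :
    g b = 0 := by
  have hder : ∀ z : ℂ, HasDerivAt (fun z : ℂ => NormedSpace.exp (z • b))
      (NormedSpace.exp (z • b) * b) z := fun z => hasDerivAt_exp_smul_const b z
  have hd : ∀ k : A →L[ℂ] ℂ, Differentiable ℂ fun z : ℂ => k (NormedSpace.exp (z • b)) :=
    fun k z => (k.hasFDerivAt.comp_hasDerivAt z (hder z)).differentiableAt
  have hf : ∀ z : ℂ, f (NormedSpace.exp (z • b)) ≠ 0 := fun z =>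
    norm_pos_iff.mp ((norm_nonneg _).trans_lt (h z))
  have hq : Differentiable ℂ fun z : ℂ =>
      g (NormedSpace.exp (z • b)) / f (NormedSpace.exp (z • b)) :=
    fun z => (hd g z).div (hd f z) (hf z)
  have hbdd : Bornology.IsBounded (Set.range fun z : ℂ =>
      g (NormedSpace.exp (z • b)) / f (NormedSpace.exp (z • b))) := by
    refine isBounded_iff_forall_norm_le.mpr ⟨1, ?_⟩
    rintro _ ⟨z, rfl⟩
    simp only [norm_div]
    exact div_le_one_of_le₀ (h z).le (norm_nonneg _)
  have hzero : (fun z : ℂ => g (NormedSpace.exp (z • b))) = fun _ => 0 := by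
    funext z
    have := hq.apply_eq_apply_of_bounded hbdd z 0
    simpa [hg, hf z] using this
  have h₀ := g.hasFDerivAt.comp_hasDerivAt 0 (hder 0)
  have h₁ : HasDerivAt (fun z : ℂ => g (NormedSpace.exp (z • b))) (g b) 0 := by
    simpa [Function.comp_def] using h₀
  rw [hzero] at h₁
  exact h₁.unique (hasDerivAt_const _ _)

/-- Associative instance of Lemma 3.5 (Kowalski–Słodkowski):
an ℝ-linear spectral-valued functional on a unital complex Banach algebra is
ℂ-linear. -/
theorem real_linear_spectral_functional_is_complex_linear
    {A : Type*} [NormedRing A] [NormedAlgebra ℂ A] [CompleteSpace A]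
    (φ : A →ₗ[ℝ] ℂ)
    (hspec : ∀ a : A, φ a ∈ spectrum ℂ a) :
    ∀ (l : ℂ) (a : A), φ (l • a) = l * φ a := by
  obtain ⟨f, g, hfg⟩ := exists_clm_add_conj_clm φ ‖(1 : A)‖ fun a => by
    rw [mul_comm]; exact spectrum.norm_le_norm_mul_of_mem (hspec a)
  have hscalar : ∀ c : ℂ, φ (c • (1 : A)) = c := by
    intro c
    by_contra hne
    refine spectrum.mem_iff.mp (hspec (c • (1 : A))) ?_
    have h := (IsUnit.mk0 _ (sub_ne_zero.mpr hne)).map (algebraMap ℂ A)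
    rwa [map_sub, Algebra.algebraMap_eq_smul_one c] at h
  have hg1 : g 1 = 0 := by
    have h₁ := hscalar 1
    have h₂ := hscalar Complex.I
    rw [hfg, map_smul, map_smul] at h₁ h₂
    simp only [smul_eq_mul, one_mul, map_mul, Complex.conj_I] at h₁ h₂
    have h₃ : 2 * Complex.I * (starRingEnd ℂ) (g 1) = 0 := by
      linear_combination Complex.I * h₁ - h₂
    simpa using h₃
  have hf1 : f 1 = 1 := by
    have h₁ := hscalar 1
    rwa [one_smul, hfg, hg1, map_zero, add_zero] at h₁
  have hunit : ∀ a : A, IsUnit a → ‖f a‖ ≠ ‖g a‖ := by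
    intro a ha hn
    obtain ⟨l, hl, h⟩ := Complex.exists_mul_add_conj_mul_eq_zero hn
    have h₀ := hspec (l • a)
    rw [hfg, map_smul, map_smul, smul_eq_mul, smul_eq_mul, h] at h₀
    refine spectrum.zero_notMem ℂ ?_ h₀
    exact ha.smul (Units.mk0 l hl)
  have hg : ∀ b, g b = 0 := by
    intro b
    refine f.apply_eq_zero_of_norm_lt_on_exp g b hg1 fun z => ?_
    by_contra! hz
    have hexp : Continuous fun z : ℂ => NormedSpace.exp (z • b) :=
      continuous_iff_continuousAt.mpr fun z => (hasDerivAt_exp_smul_const b z).continuousAt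
    obtain ⟨w, hw⟩ := intermediate_value_univ₂
      (f := fun z : ℂ => ‖f (NormedSpace.exp (z • b))‖)
      (g := fun z : ℂ => ‖g (NormedSpace.exp (z • b))‖) (a := z) (b := 0)
      (f.continuous.comp hexp).norm (g.continuous.comp hexp).norm hz (by simp [hf1, hg1])
    let _ : NormedAlgebra ℚ A := NormedAlgebra.restrictScalars ℚ ℂ A
    exact hunit _ (NormedSpace.isUnit_exp _) hw
  intro l a
  simp [hfg, hg]
end

section
/- Let A be a unital C*-algebra and let f : A → ℂ be a functional satisfying: (a) f is continuous; (b) f(x·y·x) = f(x)²·f(y) for all x, y ∈ A; (c) f(x) ∈ σ(x) for all x ∈ A. Let ψ : A → ℂ be a continuous ℂ-linear functional with ψ(xy) = ψ(x)·ψ(y) for all x, y ∈ A that agrees with f on the connected component of 1 in the set of invertible elements of A. Then for every self-adjoint x ∈ A and every λ ∈ ℂ one has f(x + λ·1) = ψ(x) + λ; in particular f(x) = ψ(x) for every self-adjoint x ∈ A. -/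
theorem IsSelfAdjoint.isUnit_add_smul_one {A : Type*} [CStarAlgebra A] {x : A}
    (hx : IsSelfAdjoint x) {l : ℂ} (hl : l.im ≠ 0) : IsUnit (x + l • (1 : A)) := by
  have h : -l ∉ spectrum ℂ x := fun h => hl <| by
    simpa using hx.im_eq_zero_of_mem_spectrum h
  rw [spectrum.notMem_iff, ← IsUnit.neg_iff] at h
  convert h using 1
  rw [Algebra.algebraMap_eq_smul_one, neg_smul]
  abel

theorem IsSelfAdjoint.add_smul_one_mem_connectedComponentIn_isUnit {A : Type*} [CStarAlgebra A]
    {x : A} (hx : IsSelfAdjoint x) {l : ℂ} (hl : l.im ≠ 0) :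
    x + l • (1 : A) ∈ connectedComponentIn {x : A | IsUnit x} 1 := by
  refine (convex_segment (𝕜 := ℝ) (1 : A) (x + l • 1)).isPreconnected.subset_connectedComponentIn
    (left_mem_segment ℝ _ _) ?_ (right_mem_segment ℝ _ _)
  rintro _ ⟨a, b, -, -, hab, rfl⟩
  rcases eq_or_ne b 0 with rfl | hb
  · obtain rfl : a = 1 := by simpa using hab
    simp
  · have hc : ((a : ℂ) + b * l).im ≠ 0 := by simp [hb, hl]
    have := ((IsSelfAdjoint.all b).smul hx).isUnit_add_smul_one hc
    rw [Set.mem_ofPred_eq]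
    convert this using 1
    simp only [Complex.coe_smul, smul_add, add_smul, mul_smul]
    abel

/-- Identity (1955)/(1956) from the proof of Theorem 4.3, in the C*-algebra
case: `f (x + λ•1) = ψ x + λ` for every self-adjoint `x`, and in particular
`f x = ψ x` for self-adjoint `x`. -/
theorem spectral_U_functional_selfadjoint_agree
    {A : Type*} [NormedRing A] [StarRing A] [CStarRing A] [CompleteSpace A]
    [NormedAlgebra ℂ A] [StarModule ℂ A]
    (f : A → ℂ)
    (hcont : Continuous f)
    (hU : ∀ x y : A, f (x * y * x) = f x ^ 2 * f y)
    (hspec : ∀ x : A, f x ∈ spectrum ℂ x)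
    (ψ : A →L[ℂ] ℂ)
    (hψmul : ∀ x y : A, ψ (x * y) = ψ x * ψ y)
    (hagree : ∀ x ∈ connectedComponentIn {x : A | IsUnit x} 1, f x = ψ x) :
    ∀ x : A, IsSelfAdjoint x →
      (∀ l : ℂ, f (x + l • (1 : A)) = ψ x + l) ∧ f x = ψ x := by
  let _ : CStarAlgebra A := {}
  have hne : (1 : A) ≠ 0 := fun h => by
    have := subsingleton_of_zero_eq_one h.symm
    simpa using hspec 0
  have : Nontrivial A := ⟨1, 0, hne⟩
  have hone : ψ 1 = 1 := by
    rw [← hagree 1 (mem_connectedComponentIn isUnit_one)]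
    simpa using hspec 1
  intro x hx
  have hdense : Dense {l : ℂ | l.im ≠ 0} :=
    (dense_compl_singleton (0 : ℝ)).preimage Complex.isOpenMap_im
  have key : (fun l : ℂ => f (x + l • (1 : A))) = fun l => ψ x + l := by
    refine Continuous.ext_on hdense (by fun_prop) (by fun_prop) fun l hl => ?_
    have hmem := hx.add_smul_one_mem_connectedComponentIn_isUnit hl
    simp [hagree _ hmem, hone]
  exact ⟨congrFun key, by simpa using congrFun key 0⟩
end

section
/- Let A be a unital C*-algebra and let f : A → ℂ be a functional satisfying: (a) f is continuous; (b) f(x·y·x) = f(x)²·f(y) for all x, y ∈ A; (c) f(x) ∈ σ(x) for all x ∈ A. Let ψ : A → ℂ be a continuous ℂ-linear functional with ψ(xy) = ψ(x)·ψ(y) for all x, y ∈ A that agrees with f on the connected component of 1 in the set of invertible elements of A. Then for all self-adjoint x, y ∈ A with x positive (i.e. 0 ≤ x), one has f(x + i·y) = ψ(x) + i·ψ(y). -/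
/-- In a unital C*-algebra, `1 + i•c` is invertible for every self-adjoint `c`. -/
theorem IsSelfAdjoint.isUnit_one_add_I_smul {A : Type*} [CStarAlgebra A] {c : A}
    (hc : IsSelfAdjoint c) : IsUnit (1 + Complex.I • c) := by
  have hI : Complex.I ∉ spectrum ℂ c := fun h => by
    simpa using hc.im_eq_zero_of_mem_spectrum h
  have hu := (spectrum.notMem_iff.mp hI).smul (Units.mk0 (-Complex.I) (by simp))
  convert hu using 1
  rw [Units.smul_mk0, smul_sub, Algebra.algebraMap_eq_smul_one, smul_smul]
  simp

/-- An element of a unital C*-algebra with strictly positive real part is invertible. -/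
theorem IsStrictlyPositive.isUnit_add_I_smul {A : Type*} [CStarAlgebra A] [PartialOrder A]
    [StarOrderedRing A] {a y : A} (ha : IsStrictlyPositive a) (hy : IsSelfAdjoint y) :
    IsUnit (a + Complex.I • y) := by
  obtain ⟨u, hu⟩ := ha.isUnit_cfcSqrt
  have hsa : star (u : A) = u := by
    rw [hu]; exact (IsSelfAdjoint.of_nonneg (CFC.sqrt_nonneg a)).star_eq
  have hsu : star u = u := Units.ext hsa
  have hinv : star (↑u⁻¹ : A) = ↑u⁻¹ := by
    rw [← Units.coe_star_inv, hsu]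
  have hc : IsSelfAdjoint ((↑u⁻¹ : A) * y * ↑u⁻¹) := by
    simp [isSelfAdjoint_iff, hinv, hy.star_eq, mul_assoc]
  have hfactor : a + Complex.I • y =
      u * (1 + Complex.I • ((↑u⁻¹ : A) * y * ↑u⁻¹)) * u := by
    have hsq : (u : A) * u = a := by
      rw [hu]; exact CFC.sqrt_mul_sqrt_self a ha.nonneg
    simp [mul_add, add_mul, mul_assoc, hsq]
  rw [hfactor]
  exact (u.isUnit.mul hc.isUnit_one_add_I_smul).mul u.isUnit

/-- Elements `r + x + i•y` with `r > 0`, `x ≥ 0` and `y` self-adjoint are invertible. -/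
theorem isUnit_smul_one_add_add_I_smul {A : Type*} [CStarAlgebra A] [PartialOrder A]
    [StarOrderedRing A] {x y : A} (hx : 0 ≤ x) (hy : IsSelfAdjoint y) {r : ℝ} (hr : 0 < r) :
    IsUnit (r • (1 : A) + x + Complex.I • y) := by
  have hr1 : IsStrictlyPositive (r • (1 : A)) :=
    ⟨smul_nonneg hr.le zero_le_one, isUnit_one.smul (Units.mk0 r hr.ne')⟩
  exact (hr1.add_nonneg hx).isUnit_add_I_smul hy

/-- Elements `r + x + i•y` with `r > 0`, `x ≥ 0` and `y` self-adjoint lie in the connected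
component of `1` in the set of invertible elements. -/
theorem smul_one_add_add_I_smul_mem_connectedComponentIn {A : Type*} [CStarAlgebra A]
    [PartialOrder A] [StarOrderedRing A] {x y : A} (hx : 0 ≤ x) (hy : IsSelfAdjoint y)
    {r : ℝ} (hr : 0 < r) :
    r • (1 : A) + x + Complex.I • y ∈ connectedComponentIn {x : A | IsUnit x} 1 := by
  let γ : ℝ → A := fun t => (1 - t + t * r) • (1 : A) + t • x + Complex.I • (t • y)
  have hγ : Continuous γ := by fun_prop
  have hpre : IsPreconnected (γ '' Set.Icc 0 1) :=
    isPreconnected_Icc.image γ hγ.continuousOn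
  have hunit : γ '' Set.Icc 0 1 ⊆ {x : A | IsUnit x} := by
    rintro _ ⟨t, ⟨ht0, ht1⟩, rfl⟩
    have hpos : 0 < 1 - t + t * r := by
      rcases ht1.lt_or_eq with h | rfl
      · have := mul_nonneg ht0 hr.le
        linarith
      · simpa using hr
    exact isUnit_smul_one_add_add_I_smul (smul_nonneg ht0 hx)
      (IsSelfAdjoint.smul (IsSelfAdjoint.all t) hy) hpos
  have h1 : (1 : A) ∈ γ '' Set.Icc 0 1 := ⟨0, by simp, by simp [γ]⟩
  exact hpre.subset_connectedComponentIn h1 hunit ⟨1, by simp, by simp [γ]⟩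

/-- Identity (2042) from the proof of Theorem 4.3, in the C*-algebra case:
`f (x + i•y) = ψ x + i * ψ y` for self-adjoint `x, y` with `x` positive. -/
theorem spectral_U_functional_positive_plus_i_selfadjoint
    {A : Type*} [NormedRing A] [StarRing A] [CStarRing A] [CompleteSpace A]
    [NormedAlgebra ℂ A] [StarModule ℂ A] [PartialOrder A] [StarOrderedRing A]
    (f : A → ℂ)
    (hcont : Continuous f)
    (hU : ∀ x y : A, f (x * y * x) = f x ^ 2 * f y)
    (hspec : ∀ x : A, f x ∈ spectrum ℂ x)
    (ψ : A →L[ℂ] ℂ)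
    (hψmul : ∀ x y : A, ψ (x * y) = ψ x * ψ y)
    (hagree : ∀ x ∈ connectedComponentIn {x : A | IsUnit x} 1, f x = ψ x) :
    ∀ x y : A, IsSelfAdjoint x → IsSelfAdjoint y → 0 ≤ x →
      f (x + Complex.I • y) = ψ x + Complex.I * ψ y := by
  let _ : CStarAlgebra A := {}
  intro x y _ hy hx
  let z : ℝ → A := fun r => r • (1 : A) + x + Complex.I • y
  have hz : Continuous z := by fun_prop
  have heq : Set.EqOn (f ∘ z) (ψ ∘ z) (Set.Ioi 0) := fun r hr =>
    hagree _ (smul_one_add_add_I_smul_mem_connectedComponentIn hx hy hr)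
  have hclosure := heq.closure (hcont.comp hz) (ψ.continuous.comp hz)
  have h0 : f (z 0) = ψ (z 0) := hclosure (by simp)
  simpa [z] using h0
end
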